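/- arXiv:2311.03728 — 8 statements merged into one kernel-verified Lean document; each statement's English description precedes it below -/
import Mathlib

section
/- (Corollary 2.5, Hadamard–Perron applied to G_λ) Under assumptions (A1)–(A3) there exists λ₀ ∈ (0,1] such that for every λ ∈ (0,λ₀] there exists a unique ψ_λ ∈ C¹(ℝ×ℝ×ℝ^{k₁}, ℝ^{k₂}) such that G_λ(graph(ψ_λ)) = graph(ψ_λ) and ψ_λ is 1-Lipschitz, i.e. ‖Dψ_λ(ω,ε,x)‖ ≤ 1 for all (ω,ε,x). -/
open Set

abbrev Euc (k : ℕ) : Type := EuclideanSpace ℝ (Fin k)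

/-- `tα_λ(ω,ε,x,y) = (0, 0, λω·(α(λω,λ²ε,x,λy) − α(0)))`. -/
noncomputable def tAl {k₁ k₂ : ℕ} (α : ℝ → ℝ → Euc k₁ → Euc k₂ → Euc k₁) (l : ℝ)
    (p : ℝ × ℝ × Euc k₁ × Euc k₂) : ℝ × ℝ × Euc k₁ :=
  (0, 0, (l * p.1) • (α (l * p.1) (l ^ 2 * p.2.1) p.2.2.1 (l • p.2.2.2) - α 0 0 0 0))

/-- `tβ_λ(ω,ε,x,y) = (1/λ)·β(λω,λ²ε,x,λy) − B y` where `B = β_y(0)`. -/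
noncomputable def tBl {k₁ k₂ : ℕ} (β : ℝ → ℝ → Euc k₁ → Euc k₂ → Euc k₂) (l : ℝ)
    (p : ℝ × ℝ × Euc k₁ × Euc k₂) : Euc k₂ :=
  (1 / l) • β (l * p.1) (l ^ 2 * p.2.1) p.2.2.1 (l • p.2.2.2) -
    fderiv ℝ (fun y : Euc k₂ => β 0 0 0 y) 0 p.2.2.2

/-- `G_λ(ω,ε,x,y) = (A_λ(ω,ε,x), By) + Ψ(λω,ε,y)·(tα_λ(ω,ε,x,y), tβ_λ(ω,ε,x,y))`,
written componentwise. -/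
noncomputable def Glam {k₁ k₂ : ℕ} (α : ℝ → ℝ → Euc k₁ → Euc k₂ → Euc k₁)
    (β : ℝ → ℝ → Euc k₁ → Euc k₂ → Euc k₂) (Ψ : ℝ → ℝ → Euc k₂ → ℝ) (l : ℝ)
    (p : ℝ × ℝ × Euc k₁ × Euc k₂) : ℝ × ℝ × Euc k₁ × Euc k₂ :=
  (p.1, p.2.1, p.2.2.1 + (l * p.1) • α 0 0 0 0 + Ψ (l * p.1) p.2.1 p.2.2.2 • (tAl α l p).2.2,
    fderiv ℝ (fun y : Euc k₂ => β 0 0 0 y) 0 p.2.2.2 + Ψ (l * p.1) p.2.1 p.2.2.2 • tBl β l p)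

/-- The graph `{(ω,ε,x,ψ(ω,ε,x))}` of `ψ : ℝ×ℝ×ℝ^{k₁} → ℝ^{k₂}`. -/
def GphT {k₁ k₂ : ℕ} (ψ : ℝ × ℝ × Euc k₁ → Euc k₂) : Set (ℝ × ℝ × Euc k₁ × Euc k₂) :=
  {p | p.2.2.2 = ψ (p.1, p.2.1, p.2.2.1)}

set_option linter.unusedSectionVars false
section abs
variable {Z Y : Type*} [NormedAddCommGroup Z] [NormedSpace ℝ Z] [CompleteSpace Z]
  [NormedAddCommGroup Y] [NormedSpace ℝ Y] [CompleteSpace Y]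

theorem hp_inv (h : Z → Z) (η : ℝ) (h0 : 0 ≤ η) (h1 : η < 1)
    (hh : ∀ z z', ‖h z - h z'‖ ≤ η * ‖z - z'‖) :
    ∃ g : Z → Z, (∀ w, g w + h (g w) = w) ∧ (∀ z, g (z + h z) = z) ∧
      ∀ w w', (1 - η) * ‖g w - g w'‖ ≤ ‖w - w'‖ := by
  have key : ∀ z z', (1 - η) * ‖z - z'‖ ≤ ‖(z + h z) - (z' + h z')‖ := by
    intro z z'
    have e : z - z' = ((z + h z) - (z' + h z')) - (h z - h z') := by abel
    have := norm_sub_le ((z + h z) - (z' + h z')) (h z - h z')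
    rw [← e] at this
    linarith [hh z z']
  have surj : ∀ w, ∃ z, z + h z = w := by
    intro w
    have hc : ContractingWith ⟨η, h0⟩ (fun z => w - h z) := by
      refine ⟨by exact_mod_cast h1, LipschitzWith.of_dist_le_mul fun z z' => ?_⟩
      rw [dist_eq_norm, dist_eq_norm]
      have : w - h z - (w - h z') = -(h z - h z') := by abel
      rw [this, norm_neg]; exact hh z z'
    refine ⟨hc.fixedPoint, ?_⟩
    have := hc.fixedPoint_isFixedPt
    have h2 : w - h hc.fixedPoint = hc.fixedPoint := this
    nth_rewrite 1 [← h2]; abel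
  choose g hg using surj
  refine ⟨g, hg, fun z => ?_, fun w w' => ?_⟩
  · have := key (g (z + h z)) z
    rw [hg] at this
    simp only [sub_self, norm_zero] at this
    have h3 : ‖g (z + h z) - z‖ = 0 := by
      have := norm_nonneg (g (z + h z) - z)
      nlinarith
    exact sub_eq_zero.1 (norm_eq_zero.1 h3)
  · simpa [hg] using key (g w) (g w')

theorem hp_graph_lip (a : Z × Y → Z) (η : ℝ) (h0 : 0 ≤ η)
    (ha : ∀ p p', ‖a p - a p'‖ ≤ η * ‖p - p'‖)
    (ψ : Z → Y) (hψ : LipschitzWith 1 ψ) (z z' : Z) :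
    ‖a (z, ψ z) - a (z', ψ z')‖ ≤ η * ‖z - z'‖ := by
  refine (ha _ _).trans (mul_le_mul_of_nonneg_left ?_ h0)
  rw [Prod.mk_sub_mk, Prod.norm_mk]
  refine max_le le_rfl ?_
  have := hψ.dist_le_mul z z'
  simpa [dist_eq_norm] using this

theorem hp_exists_lip (a : Z × Y → Z) (b : Z × Y → Y) (η κ K : ℝ) (h0 : 0 ≤ η) (k0 : 0 ≤ κ)
    (hηκ : κ + 2 * η < 1)
    (ha : ∀ p p', ‖a p - a p'‖ ≤ η * ‖p - p'‖)
    (hb : ∀ z z' y y', ‖b (z, y) - b (z', y')‖ ≤ η * ‖z - z'‖ + κ * ‖y - y'‖)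
    (hK : ∀ z, ‖b (z, 0)‖ ≤ K) :
    ∃ ψ : Z → Y, LipschitzWith 1 ψ ∧ ∀ z, ψ (z + a (z, ψ z)) = b (z, ψ z) := by
  let S : Set (BoundedContinuousFunction Z Y) := {ψ | LipschitzWith 1 ψ}
  have hS : IsClosed S := by
    have : S = ⋂ z, ⋂ z', {ψ | dist (ψ z) (ψ z') ≤ dist z z'} := by
      ext ψ
      simp only [S, mem_ofPred_eq, mem_iInter]
      rw [lipschitzWith_iff_dist_le_mul]
      simp
    rw [this]
    refine isClosed_iInter fun z => isClosed_iInter fun z' => isClosed_le ?_ continuous_const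
    exact (continuous_eval_const z).dist
      (continuous_eval_const z')
  have : CompleteSpace S := hS.completeSpace_coe
  have step : ∀ ψ : S, ∃ ψ' : S, ∀ z, ψ'.1 (z + a (z, ψ.1 z)) = b (z, ψ.1 z) := by
    intro ⟨ψ, hψ⟩
    obtain ⟨g, hg1, hg2, hg3⟩ := hp_inv (fun z => a (z, ψ z)) η h0 (by linarith)
      (hp_graph_lip a η h0 ha ψ hψ)
    have hL : LipschitzWith 1 (fun w => b (g w, ψ (g w))) := by
      refine LipschitzWith.of_dist_le_mul fun w w' => ?_
      rw [dist_eq_norm, dist_eq_norm]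
      have e1 := hb (g w) (g w') (ψ (g w)) (ψ (g w'))
      have e2 := hψ.dist_le_mul (g w) (g w')
      simp only [dist_eq_norm, NNReal.coe_one, one_mul] at e2 ⊢
      have e3 := hg3 w w'
      have := norm_nonneg (g w - g w')
      nlinarith
    refine ⟨⟨BoundedContinuousFunction.ofNormedAddCommGroup _ hL.continuous (K + κ * ‖ψ‖) ?_, ?_⟩, ?_⟩
    · intro w
      have e1 := hb (g w) (g w) (ψ (g w)) 0
      have e2 := hK (g w)
      have e3 := ψ.norm_coe_le_norm (g w)
      have e4 := norm_le_norm_add_norm_sub' (b (g w, ψ (g w))) (b (g w, 0))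
      simp only [sub_self, norm_zero, mul_zero, zero_add, sub_zero] at e1
      nlinarith
    · exact hL
    · intro z
      show b (g _, ψ (g _)) = _
      rw [hg2]
  choose T hT using step
  have hc : ContractingWith ⟨κ + η, by positivity⟩ T := by
    refine ⟨?_, LipschitzWith.of_dist_le_mul fun ψ₁ ψ₂ => ?_⟩
    · have : κ + η < 1 := by linarith
      exact_mod_cast this
    rw [Subtype.dist_eq, Subtype.dist_eq]
    have hd : 0 ≤ dist ψ₁.1 ψ₂.1 := dist_nonneg
    rw [BoundedContinuousFunction.dist_le (by show 0 ≤ (κ + η) * _; positivity)]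
    intro w
    obtain ⟨g, hg1, hg2, hg3⟩ := hp_inv (fun z => a (z, ψ₁.1 z)) η h0 (by linarith)
      (hp_graph_lip a η h0 ha ψ₁.1 ψ₁.2)
    set z := g w with hz
    have hw : z + a (z, ψ₁.1 z) = w := hg1 w
    have e1 := hT ψ₁ z
    have e2 := hT ψ₂ z
    rw [hw] at e1
    have e3 : ‖ψ₁.1 z - ψ₂.1 z‖ ≤ dist ψ₁.1 ψ₂.1 := by
      rw [← dist_eq_norm]; exact BoundedContinuousFunction.dist_coe_le_dist z
    have e4 := hb z z (ψ₁.1 z) (ψ₂.1 z)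
    have e5 := (T ψ₂).2.dist_le_mul (z + a (z, ψ₂.1 z)) w
    have e6 := ha (z, ψ₂.1 z) (z, ψ₁.1 z)
    rw [e2, NNReal.coe_one, one_mul, ← hw, dist_eq_norm, dist_eq_norm, add_sub_add_left_eq_sub, hw] at e5
    simp only [sub_self, norm_zero, mul_zero, zero_add, Prod.mk_sub_mk, Prod.norm_mk,
      norm_nonneg, max_eq_right] at e4 e6
    rw [norm_sub_rev (ψ₂.1 z)] at e6
    rw [e1, dist_eq_norm]
    have e7 := norm_sub_le_norm_sub_add_norm_sub (b (z, ψ₁.1 z)) (b (z, ψ₂.1 z)) ((T ψ₂).1 w)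
    show _ ≤ (κ + η) * _
    nlinarith
  have : Nonempty S := ⟨⟨0, ((LipschitzWith.const (0:Y)).weaken zero_le_one : LipschitzWith 1 (fun _ : Z => (0:Y)))⟩⟩
  refine ⟨hc.fixedPoint.1, hc.fixedPoint.2, fun z => ?_⟩
  have h := hT hc.fixedPoint z
  rwa [hc.fixedPoint_isFixedPt.eq] at h

theorem hp_unique (a : Z × Y → Z) (b : Z × Y → Y) (η κ : ℝ) (h0 : 0 < η) (k0 : 0 ≤ κ)
    (hηκ : κ + 2 * η < 1)
    (ha : ∀ p p', ‖a p - a p'‖ ≤ η * ‖p - p'‖)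
    (hb : ∀ z z' y y', ‖b (z, y) - b (z', y')‖ ≤ η * ‖z - z'‖ + κ * ‖y - y'‖)
    (ψ₁ ψ₂ : Z → Y) (l₁ : LipschitzWith 1 ψ₁) (l₂ : LipschitzWith 1 ψ₂)
    (i₁ : ∀ z, ψ₁ (z + a (z, ψ₁ z)) = b (z, ψ₁ z))
    (i₂ : ∀ z, ψ₂ (z + a (z, ψ₂ z)) = b (z, ψ₂ z)) : ψ₁ = ψ₂ := by
  obtain ⟨g, hg1, hg2, hg3⟩ := hp_inv (fun z => a (z, ψ₁ z)) η h0.le (by linarith)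
      (hp_graph_lip a η h0.le ha ψ₁ l₁)
  set c := ‖a (0, ψ₁ 0)‖
  set C := max (c / η) 1
  have hC1 : 1 ≤ C := le_max_right _ _
  have hC : c ≤ η * C := by
    have : c / η ≤ C := le_max_left _ _
    rw [div_le_iff₀ h0] at this; linarith
  have grow : ∀ w, (1 - η) * (C + ‖g w‖) ≤ C + ‖w‖ := by
    intro w
    have e1 := hp_graph_lip a η h0.le ha ψ₁ l₁ (g w) 0
    have e2 : g w = w - a (0, ψ₁ 0) - (a (g w, ψ₁ (g w)) - a (0, ψ₁ 0)) := by
      nth_rewrite 2 [← hg1 w]; abel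
    have e3 := norm_sub_le (w - a (0, ψ₁ 0)) (a (g w, ψ₁ (g w)) - a (0, ψ₁ 0))
    rw [← e2] at e3
    have e4 := norm_sub_le w (a (0, ψ₁ 0))
    rw [sub_zero] at e1
    linarith
  have contr : ∀ w, ‖ψ₁ w - ψ₂ w‖ ≤ (κ + η) * ‖ψ₁ (g w) - ψ₂ (g w)‖ := by
    intro w
    set z := g w with hz
    have hw : z + a (z, ψ₁ z) = w := hg1 w
    have e1 := i₁ z
    have e2 := i₂ z
    rw [hw] at e1
    have e4 := hb z z (ψ₁ z) (ψ₂ z)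
    have e5 := l₂.dist_le_mul (z + a (z, ψ₂ z)) w
    have e6 := ha (z, ψ₂ z) (z, ψ₁ z)
    rw [e2, NNReal.coe_one, one_mul, ← hw, dist_eq_norm, dist_eq_norm, add_sub_add_left_eq_sub, hw] at e5
    simp only [sub_self, norm_zero, mul_zero, zero_add, Prod.mk_sub_mk, Prod.norm_mk,
      norm_nonneg, max_eq_right] at e4 e6
    rw [norm_sub_rev (ψ₂ z)] at e6
    rw [e1]
    have e7 := norm_sub_le_norm_sub_add_norm_sub (b (z, ψ₁ z)) (b (z, ψ₂ z)) (ψ₂ w)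
    linarith
  set ρ := (κ + η) / (1 - η)
  have hρ0 : 0 ≤ ρ := div_nonneg (by linarith) (by linarith)
  have hρ1 : ρ < 1 := by rw [div_lt_one (by linarith)]; linarith
  set D := ‖ψ₁ 0 - ψ₂ 0‖ + 2
  have bd : ∀ n : ℕ, ∀ w, ‖ψ₁ w - ψ₂ w‖ ≤ ρ ^ n * (D * (C + ‖w‖)) := by
    intro n
    induction n with
    | zero =>
      intro w
      have e1 := l₁.dist_le_mul w 0
      have e2 := l₂.dist_le_mul w 0
      simp only [dist_eq_norm, NNReal.coe_one, one_mul, sub_zero] at e1 e2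
      have e3 : ψ₁ w - ψ₂ w = (ψ₁ w - ψ₁ 0) + (ψ₁ 0 - ψ₂ 0) - (ψ₂ w - ψ₂ 0) := by abel
      have e4 := norm_sub_le ((ψ₁ w - ψ₁ 0) + (ψ₁ 0 - ψ₂ 0)) (ψ₂ w - ψ₂ 0)
      have e5 := norm_add_le (ψ₁ w - ψ₁ 0) (ψ₁ 0 - ψ₂ 0)
      rw [← e3] at e4
      have := norm_nonneg w
      have := norm_nonneg (ψ₁ 0 - ψ₂ 0)
      simp only [pow_zero, one_mul, D]
      nlinarith
    | succ n ih =>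
      intro w
      have e1 := contr w
      have e2 := ih (g w)
      have e3 := grow w
      have e4 : C + ‖g w‖ ≤ (C + ‖w‖) / (1 - η) := by
        rw [le_div_iff₀ (by linarith)]; linarith
      have hD : 0 ≤ D := by positivity
      calc ‖ψ₁ w - ψ₂ w‖ ≤ (κ + η) * ‖ψ₁ (g w) - ψ₂ (g w)‖ := e1
        _ ≤ (κ + η) * (ρ ^ n * (D * ((C + ‖w‖) / (1 - η)))) := by
            gcongr; exact e2.trans (by gcongr)
        _ = _ := by simp only [ρ]; ring
  funext w
  have lim : Filter.Tendsto (fun n : ℕ => ρ ^ n * (D * (C + ‖w‖))) Filter.atTop (nhds 0) := by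
    simpa using (tendsto_pow_atTop_nhds_zero_of_lt_one hρ0 hρ1).mul_const (D * (C + ‖w‖))
  have := ge_of_tendsto' lim (fun n => bd n w)
  exact sub_eq_zero.1 (norm_le_zero_iff.1 this)

end abs
section abs2
variable {Z Y : Type*} [NormedAddCommGroup Z] [NormedSpace ℝ Z] [CompleteSpace Z]
  [NormedAddCommGroup Y] [NormedSpace ℝ Y] [CompleteSpace Y]

theorem hp_opbound (T : Z →L[ℝ] Y) (N : Z →L[ℝ] Z) (η c : ℝ) (h0 : 0 ≤ η) (h1 : η < 1)
    (hc : 0 ≤ c) (hN : ∀ v, ‖N v‖ ≤ η * ‖v‖) (hT : ∀ v, ‖T (v + N v)‖ ≤ c * ‖v‖) :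
    ‖T‖ ≤ c / (1 - η) := by
  obtain ⟨g, hg1, hg2, hg3⟩ := hp_inv N η h0 h1 (fun z z' => by rw [← map_sub]; exact hN _)
  refine ContinuousLinearMap.opNorm_le_bound _ (div_nonneg hc (by linarith)) fun w => ?_
  have e1 := hT (g w)
  have e2 := hg3 w 0
  have e0 : g 0 = 0 := by simpa using hg2 0
  rw [hg1] at e1
  rw [e0, sub_zero, sub_zero] at e2
  rw [div_mul_eq_mul_div, le_div_iff₀ (by linarith)]
  nlinarith [norm_nonneg w, norm_nonneg (g w)]

theorem hp_exists_L (φ g : Z → Z) (hg : Continuous g) (hgφ : ∀ z, g (φ z) = z)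
    (hφg : ∀ w, φ (g w) = w)
    (A : Z → (Z × Y →L[ℝ] Z)) (Bd : Z → (Z × Y →L[ℝ] Y)) (hA : Continuous A) (hB : Continuous Bd)
    (η κ : ℝ) (h0 : 0 ≤ η) (k0 : 0 ≤ κ)
    (hηκ : κ + 2 * η < 1) (hAb : ∀ z p, ‖A z p‖ ≤ η * ‖p‖)
    (hBb : ∀ z u v, ‖Bd z (u, v)‖ ≤ η * ‖u‖ + κ * ‖v‖) :
    ∃ L : Z → (Z →L[ℝ] Y), Continuous L ∧ (∀ z, ‖L z‖ ≤ 1) ∧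
      ∀ z v, L (φ z) (v + A z (v, L z v)) = Bd z (v, L z v) := by
  let S : Set (BoundedContinuousFunction Z (Z →L[ℝ] Y)) := {L | ∀ z, ‖L z‖ ≤ 1}
  have hS : IsClosed S := by
    have : S = ⋂ z, {L | ‖L z‖ ≤ 1} := by
      ext ψ
      simp only [S, mem_ofPred_eq, mem_iInter]
    rw [this]
    refine isClosed_iInter fun z => isClosed_le ?_ continuous_const
    exact (continuous_eval_const z).norm
  have : CompleteSpace S := hS.completeSpace_coe
  have hpn : ∀ (L : Z →L[ℝ] Y), ‖L‖ ≤ 1 → ∀ v, ‖L v‖ ≤ ‖v‖ := fun L hL v => by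
    simpa using L.le_of_opNorm_le hL v
  have hNb : ∀ (L : Z →L[ℝ] Y), ‖L‖ ≤ 1 → ∀ z v,
      ‖(A z).comp ((ContinuousLinearMap.id ℝ Z).prod L) v‖ ≤ η * ‖v‖ := by
    intro L hL z v
    refine (hAb z _).trans (mul_le_mul_of_nonneg_left ?_ h0)
    show ‖((v, L v) : Z × Y)‖ ≤ _
    rw [Prod.norm_mk]
    exact max_le le_rfl (hpn L hL v)
  have step : ∀ L : S, ∃ L' : S, ∀ z v, L'.1 (φ z) (v + A z (v, L.1 z v)) = Bd z (v, L.1 z v) := by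
    intro ⟨L, hL⟩
    let N : Z → (Z →L[ℝ] Z) := fun z => (A z).comp ((ContinuousLinearMap.id ℝ Z).prod (L z))
    have hLc : Continuous fun z => (ContinuousLinearMap.id ℝ Z).prod (L z) := by
      exact (ContinuousLinearMap.prodₗᵢ (𝕜 := ℝ) (E := Z) (F := Z) (G := Y) ℝ).continuous.comp
        (continuous_const.prodMk L.continuous)
    have hN : Continuous N := hA.clm_comp hLc
    have hN1 : ∀ z, ‖N z‖ ≤ η := fun z =>
      ContinuousLinearMap.opNorm_le_bound _ h0 (hNb _ (hL z) z)
    have hU : ∀ z, IsUnit (1 + N z) := by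
      intro z
      have := isUnit_one_sub_of_norm_lt_one (x := -(N z)) (by
        rw [norm_neg]; exact (hN1 z).trans_lt (by linarith))
      simpa using this
    let I : Z → (Z →L[ℝ] Z) := fun z => Ring.inverse (1 + N z)
    have hI : Continuous I := by
      rw [continuous_iff_continuousAt]
      intro z
      obtain ⟨u, hu⟩ := hU z
      have e := NormedRing.inverse_continuousAt u
      rw [hu] at e
      exact ContinuousAt.comp (f := fun z => 1 + N z) e (continuous_const.add hN).continuousAt
    let Q : Z → (Z →L[ℝ] Y) := fun z =>
      ((Bd z).comp ((ContinuousLinearMap.id ℝ Z).prod (L z))).comp (I z)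
    have hQ : Continuous Q := (hB.clm_comp hLc).clm_comp hI
    have hQe : ∀ z v, Q z (v + A z (v, L z v)) = Bd z (v, L z v) := by
      intro z v
      have e := Ring.inverse_mul_cancel _ (hU z)
      have e2 : I z (v + A z (v, L z v)) = v := by
        have := congrArg (fun F : Z →L[ℝ] Z => F v) e
        simpa [I, N] using this
      show Bd z (I z (v + A z (v, L z v)), L z (I z (v + A z (v, L z v)))) = _
      rw [e2]
    have hQ1 : ∀ z, ‖Q z‖ ≤ 1 := by
      intro z
      have := hp_opbound (Q z) (N z) η (κ + η) h0 (by linarith) (by linarith)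
        (hNb _ (hL z) z) (fun v => by
          have e := hQe z v
          show ‖Q z (v + A z (v, L z v))‖ ≤ _
          rw [e]
          have := hBb z v (L z v)
          have := hpn _ (hL z) v
          nlinarith)
      refine this.trans ?_
      rw [div_le_one (by linarith)]; linarith
    refine ⟨⟨BoundedContinuousFunction.ofNormedAddCommGroup (fun w => Q (g w)) (hQ.comp hg) 1
      (fun w => hQ1 _), fun w => hQ1 _⟩, fun z v => ?_⟩
    show Q (g (φ z)) _ = _
    rw [hgφ, hQe]
  choose T hT using step
  have hr0 : 0 ≤ (κ + η) / (1 - η) := div_nonneg (by linarith) (by linarith)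
  have hc : ContractingWith ⟨(κ + η) / (1 - η), hr0⟩ T := by
    refine ⟨?_, LipschitzWith.of_dist_le_mul fun L₁ L₂ => ?_⟩
    · have : (κ + η) / (1 - η) < 1 := by rw [div_lt_one (by linarith)]; linarith
      exact_mod_cast this
    rw [Subtype.dist_eq, Subtype.dist_eq]
    have hd : 0 ≤ dist L₁.1 L₂.1 := dist_nonneg
    rw [BoundedContinuousFunction.dist_le (by show 0 ≤ (κ + η) / (1 - η) * _; positivity)]
    intro w
    rw [← hφg w]
    set z := g w
    rw [dist_eq_norm]
    have e3 : ‖L₁.1 z - L₂.1 z‖ ≤ dist L₁.1 L₂.1 := by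
      rw [← dist_eq_norm]; exact BoundedContinuousFunction.dist_coe_le_dist z
    have := hp_opbound ((T L₁).1 (φ z) - (T L₂).1 (φ z))
      ((A z).comp ((ContinuousLinearMap.id ℝ Z).prod (L₁.1 z))) η ((κ + η) * dist L₁.1 L₂.1) h0
      (by linarith) (by positivity) (hNb _ (L₁.2 z) z) (fun v => by
        show ‖((T L₁).1 (φ z) - (T L₂).1 (φ z)) (v + A z (v, L₁.1 z v))‖ ≤ _
        have e1 := hT L₁ z v
        have e2 := hT L₂ z v
        set d := (L₁.1 z - L₂.1 z) v with hd'
        have hdv : ‖d‖ ≤ dist L₁.1 L₂.1 * ‖v‖ := ContinuousLinearMap.le_of_opNorm_le _ e3 v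
        have e4 : ((v, L₁.1 z v) : Z × Y) = (v, L₂.1 z v) + (0, d) := by
          simp [hd']
        have e5 : ((T L₁).1 (φ z) - (T L₂).1 (φ z)) (v + A z (v, L₁.1 z v)) =
            Bd z (0, d) - (T L₂).1 (φ z) (A z (0, d)) := by
          rw [sub_apply, e1, e4, map_add (Bd z), map_add (A z), ← add_assoc,
            map_add ((T L₂).1 (φ z)), e2]
          abel
        rw [e5]
        have f1 := norm_sub_le (Bd z (0, d)) ((T L₂).1 (φ z) (A z (0, d)))
        have f2 := hpn _ ((T L₂).2 (φ z)) (A z (0, d))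
        have f3 := hAb z (0, d)
        have f4 := hBb z 0 d
        simp only [Prod.norm_mk, norm_zero, norm_nonneg, max_eq_right, mul_zero, zero_add] at f3 f4
        nlinarith)
    refine this.trans (le_of_eq ?_)
    show _ = (κ + η) / (1 - η) * _
    ring
  obtain ⟨L, hfix, -⟩ := hc.exists_fixedPoint (⟨0, fun z => by simp⟩ : S) (edist_ne_top _ _)
  refine ⟨L.1, L.1.continuous, L.2, fun z v => ?_⟩
  have h := hT L z v
  rwa [hfix.eq] at h

open Filter Topology in
theorem hp_diff (a : Z × Y → Z) (b : Z × Y → Y) (da : Differentiable ℝ a)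
    (db : Differentiable ℝ b) (η κ : ℝ) (h0 : 0 ≤ η) (k0 : 0 ≤ κ)
    (hηκ : κ + 2 * η < 1)
    (hAb : ∀ q p, ‖fderiv ℝ a q p‖ ≤ η * ‖p‖)
    (hBb : ∀ q u v, ‖fderiv ℝ b q (u, v)‖ ≤ η * ‖u‖ + κ * ‖v‖)
    (ψ : Z → Y) (hψ : LipschitzWith 1 ψ) (g : Z → Z)
    (hg1 : ∀ w, g w + a (g w, ψ (g w)) = w)
    (hg3 : ∀ w w', (1 - η) * ‖g w - g w'‖ ≤ ‖w - w'‖)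
    (hgc : Continuous g)
    (inv : ∀ z, ψ (z + a (z, ψ z)) = b (z, ψ z))
    (L : Z → (Z →L[ℝ] Y)) (hL1 : ∀ z, ‖L z‖ ≤ 1)
    (hL : ∀ z v, L (z + a (z, ψ z)) (v + fderiv ℝ a (z, ψ z) (v, L z v)) =
      fderiv ℝ b (z, ψ z) (v, L z v)) (z : Z) : HasFDerivAt ψ (L z) z := by
  have hpn : ∀ z v, ‖L z v‖ ≤ ‖v‖ := fun z v => by
    simpa using (L z).le_of_opNorm_le (hL1 z) v
  have hψ' : ∀ z z', ‖ψ z' - ψ z‖ ≤ ‖z' - z‖ := fun z z' => by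
    simpa [dist_eq_norm] using hψ.dist_le_mul z' z
  set ρ := (κ + η) / (1 - η) with hρ
  have hρ0 : 0 ≤ ρ := div_nonneg (by linarith) (by linarith)
  have hρ1 : ρ < 1 := by rw [hρ, div_lt_one (by linarith)]; linarith
  have hρe : ρ * (1 - η) = κ + η := div_mul_cancel₀ _ (by linarith)
  set ρ' := (1 + ρ) / 2 with hρ'
  let P : ℝ → Prop := fun c => ∀ z, ∀ᶠ z' in 𝓝 z, ‖ψ z' - ψ z - L z (z' - z)‖ ≤ c * ‖z' - z‖
  have step : ∀ c, 0 < c → P c → P (ρ' * c) := by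
    intro c hc hP w
    set z := g w with hz
    have hw : z + a (z, ψ z) = w := hg1 w
    set δ := (ρ' - ρ) * (1 - η) * c / 2 with hδ
    have hδ0 : 0 < δ := by
      have : 0 < ρ' - ρ := by rw [hρ']; linarith
      have : 0 < 1 - η := by linarith
      positivity
    have tg : Tendsto g (𝓝 w) (𝓝 z) := hgc.tendsto w
    have tG : Tendsto (fun w' => (g w', ψ (g w'))) (𝓝 w) (𝓝 (z, ψ z)) :=
      (hgc.prodMk (hψ.continuous.comp hgc)).tendsto w
    have ea := tG.eventually ((hasFDerivAt_iff_isLittleO.1 (da (z, ψ z)).hasFDerivAt).bound hδ0)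
    have eb := tG.eventually ((hasFDerivAt_iff_isLittleO.1 (db (z, ψ z)).hasFDerivAt).bound hδ0)
    filter_upwards [tg.eventually (hP z), ea, eb] with w' h1 h2 h3
    set z' := g w' with hz'
    have hw' : z' + a (z', ψ z') = w' := hg1 w'
    have n1 : ‖(z', ψ z') - (z, ψ z)‖ ≤ ‖z' - z‖ := by
      rw [Prod.mk_sub_mk, Prod.norm_mk]; exact max_le le_rfl (hψ' _ _)
    set h := z' - z with hh
    set e := ψ z' - ψ z - L z h with he
    have n2 : (z', ψ z') - (z, ψ z) = (h, L z h) + (0, e) := by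
      simp [he, hh]
    set ra := a (z', ψ z') - a (z, ψ z) - fderiv ℝ a (z, ψ z) ((z', ψ z') - (z, ψ z)) with hra
    set rb := b (z', ψ z') - b (z, ψ z) - fderiv ℝ b (z, ψ z) ((z', ψ z') - (z, ψ z)) with hrb
    have q1 : w' - w = (h + fderiv ℝ a (z, ψ z) (h, L z h)) + fderiv ℝ a (z, ψ z) (0, e) + ra := by
      rw [hra, n2, map_add, ← hw, ← hw', hh]; abel
    have q2 : ψ w' - ψ w = fderiv ℝ b (z, ψ z) (h, L z h) + fderiv ℝ b (z, ψ z) (0, e) + rb := by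
      rw [hrb, n2, map_add, ← hw, ← hw', inv, inv]; abel
    have q3 : ψ w' - ψ w - L w (w' - w) = fderiv ℝ b (z, ψ z) (0, e) + rb
        - L w (fderiv ℝ a (z, ψ z) (0, e)) - L w ra := by
      have := hL z h
      rw [hw] at this
      rw [q2, q1, map_add, map_add, this]; abel
    rw [q3]
    have f0 := norm_sub_le (fderiv ℝ b (z, ψ z) (0, e) + rb
        - L w (fderiv ℝ a (z, ψ z) (0, e))) (L w ra)
    have f1 := norm_sub_le (fderiv ℝ b (z, ψ z) (0, e) + rb) (L w (fderiv ℝ a (z, ψ z) (0, e)))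
    have f2 := norm_add_le (fderiv ℝ b (z, ψ z) (0, e)) rb
    have f3 := hBb (z, ψ z) 0 e
    have f4 := hAb (z, ψ z) (0, e)
    have f5 := hpn w (fderiv ℝ a (z, ψ z) (0, e))
    have f6 := hpn w ra
    simp only [Prod.norm_mk, norm_zero, norm_nonneg, max_eq_right, mul_zero, zero_add] at f3 f4
    have f7 : ‖ra‖ ≤ δ * ‖h‖ := h2.trans (by gcongr)
    have f8 : ‖rb‖ ≤ δ * ‖h‖ := h3.trans (by gcongr)
    have f9 : (1 - η) * ‖h‖ ≤ ‖w' - w‖ := hg3 w' w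
    have f10 : κ * ‖e‖ ≤ κ * (c * ‖h‖) := by gcongr
    have f11 : η * ‖e‖ ≤ η * (c * ‖h‖) := by gcongr
    have hρ'0 : 0 ≤ ρ' * c := by have : 0 ≤ ρ' := by linarith
                                 positivity
    have f12 : ρ' * c * ((1 - η) * ‖h‖) ≤ ρ' * c * ‖w' - w‖ := by gcongr
    have f13 : (κ + η) * c * ‖h‖ + 2 * (δ * ‖h‖) = ρ' * c * ((1 - η) * ‖h‖) := by
      rw [hδ, ← hρe]; ring
    linarith
  have hρ'1 : ρ' < 1 := by linarith
  have hρ'0 : 0 < ρ' := by linarith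
  have all : ∀ n : ℕ, P (ρ' ^ n * 2) := by
    intro n
    induction n with
    | zero =>
      intro z
      refine Eventually.of_forall fun z' => ?_
      have := norm_sub_le (ψ z' - ψ z) (L z (z' - z))
      have := hψ' z z'
      have := hpn z (z' - z)
      linarith
    | succ n ih =>
      have := step _ (by positivity) ih
      rw [pow_succ']
      rwa [mul_assoc]
  rw [hasFDerivAt_iff_isLittleO, Asymptotics.isLittleO_iff]
  intro c hc
  have lim : Tendsto (fun n : ℕ => ρ' ^ n * 2) atTop (𝓝 0) := by
    simpa using (tendsto_pow_atTop_nhds_zero_of_lt_one hρ'0.le hρ'1).mul_const 2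
  obtain ⟨n, hn⟩ := (lim.eventually (gt_mem_nhds hc)).exists
  filter_upwards [all n z] with z' hz'
  exact hz'.trans (by gcongr)

theorem hp_main (a : Z × Y → Z) (b : Z × Y → Y) (ca : ContDiff ℝ 1 a)
    (cb : ContDiff ℝ 1 b) (η κ K : ℝ) (h0 : 0 < η) (k0 : 0 ≤ κ)
    (hηκ : κ + 2 * η < 1)
    (hAb : ∀ q p, ‖fderiv ℝ a q p‖ ≤ η * ‖p‖)
    (hBb : ∀ q u v, ‖fderiv ℝ b q (u, v)‖ ≤ η * ‖u‖ + κ * ‖v‖)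
    (hK : ∀ z, ‖b (z, 0)‖ ≤ K) :
    ∃ ψ : Z → Y, (ContDiff ℝ 1 ψ ∧ (∀ z, ψ (z + a (z, ψ z)) = b (z, ψ z)) ∧
      (∀ w, ∃ z, z + a (z, ψ z) = w) ∧ ∀ z, ‖fderiv ℝ ψ z‖ ≤ 1) ∧
      ∀ ψ' : Z → Y, ContDiff ℝ 1 ψ' → (∀ z, ψ' (z + a (z, ψ' z)) = b (z, ψ' z)) →
        (∀ z, ‖fderiv ℝ ψ' z‖ ≤ 1) → ψ' = ψ := by
  have da := ca.differentiable one_ne_zero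
  have db := cb.differentiable one_ne_zero
  have ha : ∀ p p', ‖a p - a p'‖ ≤ η * ‖p - p'‖ := fun p p' =>
    convex_univ.norm_image_sub_le_of_norm_fderiv_le (fun x _ => da x)
      (fun x _ => ContinuousLinearMap.opNorm_le_bound _ h0.le (hAb x)) (mem_univ p') (mem_univ p)
  have hb : ∀ z z' y y', ‖b (z, y) - b (z', y')‖ ≤ η * ‖z - z'‖ + κ * ‖y - y'‖ := by
    intro z z' y y'
    have e1 : ‖b (z, y) - b (z', y)‖ ≤ η * ‖z - z'‖ := by
      refine convex_univ.norm_image_sub_le_of_norm_hasFDerivWithin_le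
        (f := fun z => b (z, y)) (f' := fun z => (fderiv ℝ b (z, y)).comp
          (ContinuousLinearMap.inl ℝ Z Y)) (fun x _ => ?_)
        (fun x _ => ContinuousLinearMap.opNorm_le_bound _ h0.le fun u => ?_) (mem_univ z') (mem_univ z)
      · exact ((db (x, y)).hasFDerivAt.comp x (hasFDerivAt_prodMk_left x y)).hasFDerivWithinAt
      · simpa using hBb (x, y) u 0
    have e2 : ‖b (z', y) - b (z', y')‖ ≤ κ * ‖y - y'‖ := by
      refine convex_univ.norm_image_sub_le_of_norm_hasFDerivWithin_le
        (f := fun y => b (z', y)) (f' := fun y => (fderiv ℝ b (z', y)).comp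
          (ContinuousLinearMap.inr ℝ Z Y)) (fun x _ => ?_)
        (fun x _ => ContinuousLinearMap.opNorm_le_bound _ k0 fun u => ?_) (mem_univ y') (mem_univ y)
      · exact ((db (z', x)).hasFDerivAt.comp x (hasFDerivAt_prodMk_right z' x)).hasFDerivWithinAt
      · simpa using hBb (z', x) 0 u
    linarith [norm_sub_le_norm_sub_add_norm_sub (b (z, y)) (b (z', y)) (b (z', y'))]
  obtain ⟨ψ, hψ, inv⟩ := hp_exists_lip a b η κ K h0.le k0 hηκ ha hb hK
  obtain ⟨g, hg1, hg2, hg3⟩ := hp_inv (fun z => a (z, ψ z)) η h0.le (by linarith)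
      (hp_graph_lip a η h0.le ha ψ hψ)
  have hgc : Continuous g := by
    refine (LipschitzWith.of_dist_le_mul (K := Real.toNNReal (1 / (1 - η))) fun w w' => ?_).continuous
    have : 0 < 1 - η := by linarith
    rw [Real.coe_toNNReal _ (by positivity), dist_eq_norm, dist_eq_norm, div_mul_eq_mul_div,
      le_div_iff₀ this]
    linarith [hg3 w w']
  have hG : Continuous fun z => (z, ψ z) := continuous_id.prodMk hψ.continuous
  obtain ⟨L, hLc, hL1, hL⟩ := hp_exists_L (fun z => z + a (z, ψ z)) g hgc hg2 hg1
    (fun z => fderiv ℝ a (z, ψ z)) (fun z => fderiv ℝ b (z, ψ z))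
    ((ca.continuous_fderiv one_ne_zero).comp hG) ((cb.continuous_fderiv one_ne_zero).comp hG)
    η κ h0.le k0 hηκ (fun z => hAb _) (fun z => hBb _)
  have hd := hp_diff a b da db η κ h0.le k0 hηκ hAb hBb ψ hψ g hg1 hg3 hgc inv L hL1 hL
  refine ⟨ψ, ⟨contDiff_one_iff_hasFDerivAt.2 ⟨L, hLc, hd⟩, inv, fun w => ⟨g w, hg1 w⟩,
    fun z => by rw [(hd z).fderiv]; exact hL1 z⟩, fun ψ' c' i' n' => ?_⟩
  refine hp_unique a b η κ h0 k0 hηκ ha hb ψ' ψ ?_ hψ i' inv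
  exact lipschitzWith_of_nnnorm_fderiv_le (c'.differentiable one_ne_zero)
    (fun z => by exact_mod_cast n' z)
end abs2

section est
variable {X V F : Type*} [NormedAddCommGroup X] [NormedSpace ℝ X]
  [NormedAddCommGroup V] [NormedSpace ℝ V] [NormedAddCommGroup F] [NormedSpace ℝ F]

theorem hp_D1 (f : ℝ × ℝ × X × V → F) (df : Differentiable ℝ f)
    (h2 : ∀ (ω ω' : ℝ) (x x' : X) (y : V), f (ω, 0, x, y) = f (ω', 0, x', y))
    (ω : ℝ) (x : X) (y : V) (u : ℝ) (v : X) : fderiv ℝ f (ω, 0, x, y) (u, 0, v, 0) = 0 := by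
  rw [← (df _).lineDeriv_eq_fderiv, lineDeriv]
  have : (fun t : ℝ => f ((ω, 0, x, y) + t • (u, 0, v, 0))) = fun _ => f (0, 0, 0, y) := by
    funext t
    simpa using h2 (ω + t * u) 0 (x + t • v) 0 y
  rw [this]; simp

theorem hp_D2 (f : ℝ × ℝ × X × V → F) (df : Differentiable ℝ f)
    (h2 : ∀ (ω ω' : ℝ) (x x' : X) (y : V), f (ω, 0, x, y) = f (ω', 0, x', y))
    (ω : ℝ) (x : X) (y : V) (v : V) : fderiv ℝ f (ω, 0, x, y) (0, 0, 0, v) =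
      fderiv ℝ (fun y => f (0, 0, 0, y)) y v := by
  have d2 : Differentiable ℝ (fun y : V => f (0, 0, 0, y)) := by fun_prop
  rw [← (df _).lineDeriv_eq_fderiv, ← (d2 _).lineDeriv_eq_fderiv, lineDeriv, lineDeriv]
  congr 1
  funext t
  simpa using h2 ω 0 x 0 (y + t • v)

/-- Region. -/
def hpR (X V : Type*) [NormedAddCommGroup V] (A r : ℝ) : Set (ℝ × ℝ × X × V) :=
  {p | |p.1| ≤ A ∧ |p.2.1| ≤ r ∧ ‖p.2.2.2‖ ≤ r}

theorem hpR_convex (A r : ℝ) : Convex ℝ (hpR X V A r) := by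
  have e : hpR X V A r = Metric.closedBall (0:ℝ) A ×ˢ Metric.closedBall (0:ℝ) r ×ˢ
      (univ : Set X) ×ˢ Metric.closedBall (0:V) r := by
    ext ⟨a, b, c, d⟩
    simp [hpR, Real.norm_eq_abs]
  rw [e]
  exact (convex_closedBall _ _).prod ((convex_closedBall _ _).prod
    (convex_univ.prod (convex_closedBall _ _)))

theorem hp_mv (f : ℝ × ℝ × X × V → F) (df : Differentiable ℝ f) (A r c : ℝ) (hr : 0 ≤ r)
    (hc : 0 ≤ c) (hb : ∀ p ∈ hpR X V A r, ‖fderiv ℝ f p‖ ≤ c)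
    (h0 : ∀ ω x, f (ω, 0, x, 0) = 0) : ∀ p ∈ hpR X V A r, ‖f p‖ ≤ c * r := by
  rintro ⟨ω, ε, x, y⟩ hp
  have hq : (ω, (0:ℝ), x, (0:V)) ∈ hpR X V A r := ⟨hp.1, by simpa using hr, by simpa using hr⟩
  have := (hpR_convex A r).norm_image_sub_le_of_norm_fderiv_le (fun x _ => df x) hb hq hp
  rw [h0, sub_zero] at this
  refine this.trans (mul_le_mul_of_nonneg_left ?_ hc)
  have h1 := hp.2.1
  have h2 := hp.2.2
  simp only [Prod.mk_sub_mk, Prod.norm_mk, sub_self, sub_zero, norm_zero, Real.norm_eq_abs]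
  simp [h1, h2]

theorem hp_cut (f : ℝ × ℝ × X × V → F) (df : Differentiable ℝ f) (A r c D : ℝ) (hr : 0 ≤ r)
    (hc : 0 ≤ c) (hb : ∀ p ∈ hpR X V A r, ‖fderiv ℝ f p‖ ≤ c)
    (h0 : ∀ ω x, f (ω, 0, x, 0) = 0)
    (χ : ℝ × ℝ × X × V → ℝ) (dχ : Differentiable ℝ χ) (c0 : ∀ p, 0 ≤ χ p) (c1 : ∀ p, χ p ≤ 1)
    (cz : ∀ p, p ∉ hpR X V A r → χ p = 0) (hD : ∀ p, ‖fderiv ℝ χ p‖ ≤ D) (p : ℝ × ℝ × X × V) :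
    ‖fderiv ℝ (fun p => χ p • f p) p‖ ≤ c * (1 + r * D) ∧ ‖χ p • f p‖ ≤ c * r := by
  have hD0 : 0 ≤ D := (norm_nonneg _).trans (hD 0)
  have e : fderiv ℝ (fun p => χ p • f p) p = χ p • fderiv ℝ f p + (fderiv ℝ χ p).smulRight (f p) :=
    ((dχ p).hasFDerivAt.smul (df p).hasFDerivAt).fderiv
  rw [e]
  by_cases hp : p ∈ hpR X V A r
  · have m := hp_mv f df A r c hr hc hb h0 p hp
    have n1 : ‖χ p‖ ≤ 1 := by rw [Real.norm_eq_abs, abs_of_nonneg (c0 p)]; exact c1 p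
    constructor
    · refine (norm_add_le _ _).trans ?_
      rw [norm_smul, ContinuousLinearMap.norm_smulRight_apply]
      calc _ ≤ 1 * c + D * (c * r) := by
            gcongr
            · exact hb p hp
            · exact hD p
        _ = _ := by ring
    · rw [norm_smul]
      calc _ ≤ 1 * (c * r) := by gcongr
        _ = _ := by ring
  · have z := cz p hp
    have z' : fderiv ℝ χ p = 0 := by
      refine IsLocalMin.fderiv_eq_zero (Filter.Eventually.of_forall fun p' => ?_)
      rw [z]; exact c0 p'
    rw [z, z']
    simp
    constructor <;> positivity

/-- scaling -/
noncomputable def hpS (X V : Type*) [NormedAddCommGroup X] [NormedSpace ℝ X]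
  [NormedAddCommGroup V] [NormedSpace ℝ V] (l : ℝ) : (ℝ × ℝ × X × V) →L[ℝ] (ℝ × ℝ × X × V) :=
  (l • ContinuousLinearMap.id ℝ ℝ).prodMap ((l ^ 2 • ContinuousLinearMap.id ℝ ℝ).prodMap
    ((ContinuousLinearMap.id ℝ X).prodMap (l • ContinuousLinearMap.id ℝ V)))

theorem hpS_apply (l : ℝ) (ω ε : ℝ) (x : X) (y : V) :
    hpS X V l (ω, ε, x, y) = (l * ω, l ^ 2 * ε, x, l • y) := by
  simp [hpS]

theorem hp_norm4 (ω ε : ℝ) (x : X) (y : V) (c : ℝ) (h1 : |ω| ≤ c) (h2 : |ε| ≤ c) (h3 : ‖x‖ ≤ c)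
    (h4 : ‖y‖ ≤ c) : ‖(ω, ε, x, y)‖ ≤ c := by
  simp only [Prod.norm_mk, Real.norm_eq_abs]
  exact max_le h1 (max_le h2 (max_le h3 h4))

theorem hp_norm4' (ω ε : ℝ) (x : X) (y : V) : |ω| ≤ ‖(ω, ε, x, y)‖ ∧ |ε| ≤ ‖(ω, ε, x, y)‖ ∧
    ‖x‖ ≤ ‖(ω, ε, x, y)‖ ∧ ‖y‖ ≤ ‖(ω, ε, x, y)‖ := by
  simp only [Prod.norm_mk, Real.norm_eq_abs]
  simp

theorem hp_E1 (f : ℝ × ℝ × X × V → F) (df : Differentiable ℝ f)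
    (h2 : ∀ (ω ω' : ℝ) (x x' : X) (y : V), f (ω, 0, x, y) = f (ω', 0, x', y))
    (C M : ℝ) (hC : 0 ≤ C) (hM0 : 0 ≤ M)
    (hM2 : ∀ p ∈ hpR X V C C, ∀ p' ∈ hpR X V C C, ‖fderiv ℝ f p - fderiv ℝ f p'‖ ≤ M * ‖p - p'‖)
    (ω ε : ℝ) (x : X) (y : V) (hp : (ω, ε, x, y) ∈ hpR X V C C) (u : ℝ) (v : X) (n : ℝ)
    (hu : |u| ≤ n) (hv : ‖v‖ ≤ n) :
    ‖fderiv ℝ f (ω, ε, x, y) (u, 0, v, 0)‖ ≤ M * |ε| * n := by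
  have hn : 0 ≤ n := (abs_nonneg _).trans hu
  have e1 := hM2 _ hp (ω, 0, x, y) ⟨hp.1, by simpa using hC, hp.2.2⟩
  have e2 : ‖(ω, ε, x, y) - (ω, 0, x, y)‖ ≤ |ε| := by
    simp
  have e3 : fderiv ℝ f (ω, ε, x, y) (u, 0, v, 0) =
      (fderiv ℝ f (ω, ε, x, y) - fderiv ℝ f (ω, 0, x, y)) (u, 0, v, 0) := by
    rw [sub_apply, hp_D1 f df h2, sub_zero]
  rw [e3]
  refine (ContinuousLinearMap.le_opNorm _ _).trans ?_
  gcongr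
  · exact e1.trans (by gcongr)
  · exact hp_norm4 _ _ _ _ _ hu (by simpa using hn) hv (by simpa using hn)

theorem hp_mem (l r C ω ε : ℝ) (x : X) (y : V) (l0 : 0 < l) (l1 : l ≤ 1)
    (h2C : 2 ≤ C) (hrC : r ≤ C) (hp : (ω, ε, x, y) ∈ hpR X V (2 / l) r) :
    (l * ω, l ^ 2 * ε, x, l • y) ∈ hpR X V C C := by
  obtain ⟨h1, h2, h3⟩ := hp
  simp only at h1 h2 h3
  rw [le_div_iff₀ l0] at h1
  refine ⟨?_, ?_, ?_⟩
  · rw [abs_mul, abs_of_pos l0]; linarith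
  · rw [abs_mul, abs_of_pos (by positivity)]
    have : l ^ 2 ≤ 1 := pow_le_one₀ l0.le l1
    nlinarith [abs_nonneg ε]
  · rw [norm_smul, Real.norm_eq_abs, abs_of_pos l0]
    nlinarith [norm_nonneg y]

theorem hp_alpha (f : ℝ × ℝ × X × V → F) (df : Differentiable ℝ f)
    (h2 : ∀ (ω ω' : ℝ) (x x' : X) (y : V), f (ω, 0, x, y) = f (ω', 0, x', y))
    (C M r l : ℝ) (h2C : 2 ≤ C) (hrC : r ≤ C) (hr : 0 ≤ r) (hM0 : 0 ≤ M) (l0 : 0 < l) (l1 : l ≤ 1)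
    (hM1 : ∀ p ∈ hpR X V C C, ‖fderiv ℝ f p‖ ≤ M)
    (hM2 : ∀ p ∈ hpR X V C C, ∀ p' ∈ hpR X V C C, ‖fderiv ℝ f p - fderiv ℝ f p'‖ ≤ M * ‖p - p'‖) :
    ∀ p ∈ hpR X V (2 / l) r,
    ‖fderiv ℝ (fun p : ℝ × ℝ × X × V => (l * p.1) • (f (hpS X V l p) - f 0)) p‖
      ≤ l * (M * (r + 1) * (r + 2)) := by
  have dS : ∀ p, HasFDerivAt (fun p => f (hpS X V l p) - f 0)
      ((fderiv ℝ f (hpS X V l p)).comp (hpS X V l)) p := fun p =>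
    ((df _).hasFDerivAt.comp p (hpS X V l).hasFDerivAt).sub_const _
  have b1 : ∀ p ∈ hpR X V (2 / l) r, ‖fderiv ℝ (fun p => f (hpS X V l p) - f 0) p‖
      ≤ l * (M * (r + 1)) := by
    rintro ⟨ω, ε, x, y⟩ hp
    have hm := hp_mem l r C ω ε x y l0 l1 h2C hrC hp
    rw [(dS _).fderiv]
    refine ContinuousLinearMap.opNorm_le_bound _ (by positivity) ?_
    rintro ⟨u, e, v, w⟩
    obtain ⟨n1, n2, n3, n4⟩ := hp_norm4' u e v w
    set n := ‖(u, e, v, w)‖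
    rw [ContinuousLinearMap.comp_apply, hpS_apply, hpS_apply]
    have s : ((l * u, l ^ 2 * e, v, l • w) : ℝ × ℝ × X × V) =
      (0, 0, v, 0) + (l * u, l ^ 2 * e, 0, l • w) := by simp
    rw [s, map_add]
    have hn : 0 ≤ n := norm_nonneg _
    have t1 := hp_E1 f df h2 C M (by linarith) hM0 hM2 _ _ _ _ hm 0 v n (by simpa using hn) n3
    have t2 : ‖fderiv ℝ f (l * ω, l ^ 2 * ε, x, l • y) (l * u, l ^ 2 * e, 0, l • w)‖ ≤ M * (l * n) := by
      refine (ContinuousLinearMap.le_opNorm _ _).trans ?_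
      gcongr
      · exact hM1 _ hm
      · refine hp_norm4 _ _ _ _ _ ?_ ?_ ?_ ?_
        · rw [abs_mul, abs_of_pos l0]; gcongr
        · rw [abs_mul, abs_of_pos (by positivity)]
          have : l ^ 2 ≤ l := by nlinarith
          gcongr
        · simp; positivity
        · rw [norm_smul, Real.norm_eq_abs, abs_of_pos l0]; gcongr
    have t3 : |l ^ 2 * ε| ≤ l * r := by
      rw [abs_mul, abs_of_pos (by positivity)]
      have : l ^ 2 ≤ l := by nlinarith
      have := hp.2.1
      gcongr
    have t4 : M * |l ^ 2 * ε| * n ≤ M * (l * r) * n := by gcongr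
    refine (norm_add_le _ _).trans ?_
    nlinarith
  have hz : ∀ (ω : ℝ) (x : X), (fun p => f (hpS X V l p) - f 0) (ω, 0, x, 0) = 0 := by
    intro ω x
    simp only [hpS_apply, mul_zero, smul_zero]
    rw [h2 _ 0 _ 0]; exact sub_self _
  intro p hp
  have v1 := hp_mv _ (fun p => (dS p).differentiableAt) (2 / l) r _ hr (by positivity) b1 hz p hp
  have d1 := b1 p hp
  set G := fun p => f (hpS X V l p) - f 0 with hG
  have e : HasFDerivAt (fun p : ℝ × ℝ × X × V => (l * p.1) • G p)
      ((l * p.1) • fderiv ℝ G p + (l • ContinuousLinearMap.fst ℝ ℝ (ℝ × X × V)).smulRight (G p)) p := by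
    have q1 : HasFDerivAt (fun p : ℝ × ℝ × X × V => l * p.1)
      (l • ContinuousLinearMap.fst ℝ ℝ (ℝ × X × V)) p := by
        simpa using (hasFDerivAt_fst (𝕜 := ℝ) (p := p)).const_mul l
    exact q1.smul (dS p).differentiableAt.hasFDerivAt
  rw [e.fderiv]
  refine (norm_add_le _ _).trans ?_
  rw [norm_smul, ContinuousLinearMap.norm_smulRight_apply, norm_smul]
  have g1 : ‖l * p.1‖ ≤ 2 := by
    have := hp.1
    rw [le_div_iff₀ l0] at this
    rw [norm_mul, Real.norm_eq_abs, Real.norm_eq_abs, abs_of_pos l0]; linarith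
  have g2 : ‖l‖ ≤ 1 := by rw [Real.norm_eq_abs, abs_of_pos l0]; exact l1
  have g3 := ContinuousLinearMap.norm_fst_le ℝ ℝ (ℝ × X × V)
  calc _ ≤ 2 * (l * (M * (r + 1))) + 1 * 1 * (l * (M * (r + 1)) * r) := by gcongr
    _ = _ := by ring

theorem hp_beta (f : ℝ × ℝ × X × V → F) (df : Differentiable ℝ f)
    (h2 : ∀ (ω ω' : ℝ) (x x' : X) (y : V), f (ω, 0, x, y) = f (ω', 0, x', y))
    (C M r l : ℝ) (h2C : 2 ≤ C) (hrC : r ≤ C) (hr : 0 ≤ r) (hM0 : 0 ≤ M) (l0 : 0 < l) (l1 : l ≤ 1)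
    (hM1 : ∀ p ∈ hpR X V C C, ‖fderiv ℝ f p‖ ≤ M)
    (hM2 : ∀ p ∈ hpR X V C C, ∀ p' ∈ hpR X V C C, ‖fderiv ℝ f p - fderiv ℝ f p'‖ ≤ M * ‖p - p'‖) :
    ∀ p ∈ hpR X V (2 / l) r,
    ‖fderiv ℝ (fun p : ℝ × ℝ × X × V => (1 / l) • f (hpS X V l p) -
      fderiv ℝ (fun y => f (0, 0, 0, y)) 0 p.2.2.2) p‖
      ≤ l * (M * (r + 1) * (r + 2)) := by
  set B := fderiv ℝ (fun y => f (0, 0, 0, y)) 0 with hB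
  let π : (ℝ × ℝ × X × V) →L[ℝ] V := (ContinuousLinearMap.snd ℝ X V).comp
    ((ContinuousLinearMap.snd ℝ ℝ (X × V)).comp (ContinuousLinearMap.snd ℝ ℝ (ℝ × X × V)))
  have dS : ∀ p, HasFDerivAt (fun p : ℝ × ℝ × X × V => (1 / l) • f (hpS X V l p) - B p.2.2.2)
      ((1 / l) • (fderiv ℝ f (hpS X V l p)).comp (hpS X V l) - B.comp π) p := fun p =>
    (((df _).hasFDerivAt.comp p (hpS X V l).hasFDerivAt).const_smul (1 / l)).sub
      (B.comp π).hasFDerivAt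
  rintro ⟨ω, ε, x, y⟩ hp
  have hm := hp_mem l r C ω ε x y l0 l1 h2C hrC hp
  rw [(dS _).fderiv]
  refine ContinuousLinearMap.opNorm_le_bound _ (by positivity) ?_
  rintro ⟨u, e, v, w⟩
  obtain ⟨n1, n2, n3, n4⟩ := hp_norm4' u e v w
  set n := ‖(u, e, v, w)‖
  have hn : 0 ≤ n := norm_nonneg _
  rw [sub_apply, smul_apply, ContinuousLinearMap.comp_apply, ContinuousLinearMap.comp_apply,
    hpS_apply, hpS_apply]
  have hπ : π (u, e, v, w) = w := rfl
  rw [hπ]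
  have s : ((l * u, l ^ 2 * e, v, l • w) : ℝ × ℝ × X × V) =
      (l * u, 0, v, 0) + l • (0, l * e, 0, 0) + l • (0, 0, 0, w) := by
    simp; ring
  have hl : (1 / l) * l = 1 := by field_simp
  rw [s, map_add, map_add, map_smul, map_smul, smul_add, smul_add, smul_smul, smul_smul, hl, one_smul,
    one_smul]
  have hm0 : (l * ω, (0:ℝ), x, (0:V)) ∈ hpR X V C C :=
    ⟨hm.1, by simp; linarith, by simp; linarith⟩
  rw [hB, ← hp_D2 f df h2 (l * ω) x 0 w, add_sub_assoc, ← sub_apply]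
  have t1 := hp_E1 f df h2 C M (by linarith) hM0 hM2 _ _ _ _ hm (l * u) v n
    (by rw [abs_mul, abs_of_pos l0]; nlinarith [abs_nonneg u]) n3
  have t2 : ‖fderiv ℝ f (l * ω, l ^ 2 * ε, x, l • y) (0, l * e, 0, 0)‖ ≤ M * (l * n) := by
    refine (ContinuousLinearMap.le_opNorm _ _).trans ?_
    gcongr
    · exact hM1 _ hm
    · refine hp_norm4 _ _ _ _ _ ?_ ?_ ?_ ?_
      · simp; positivity
      · rw [abs_mul, abs_of_pos l0]; gcongr
      · simp; positivity
      · simp; positivity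
  have hε : |ε| ≤ r := hp.2.1
  have hy : ‖y‖ ≤ r := hp.2.2
  have t3' : |l ^ 2 * ε| ≤ l ^ 2 * r := by
    rw [abs_mul, abs_of_pos (by positivity)]
    gcongr
  have t3 : |l ^ 2 * ε| ≤ l * r := by
    refine t3'.trans ?_
    have : l ^ 2 ≤ l := by nlinarith
    gcongr
  have t4 : ‖(fderiv ℝ f (l * ω, l ^ 2 * ε, x, l • y) - fderiv ℝ f (l * ω, 0, x, 0)) (0, 0, 0, w)‖
      ≤ M * (l * r) * n := by
    refine (ContinuousLinearMap.le_opNorm _ _).trans ?_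
    gcongr
    · refine (hM2 _ hm _ hm0).trans ?_
      gcongr
      rw [Prod.mk_sub_mk, Prod.mk_sub_mk, Prod.mk_sub_mk]
      refine hp_norm4 _ _ _ _ _ ?_ ?_ ?_ ?_
      · simp; positivity
      · simpa using t3
      · simp; positivity
      · rw [sub_zero, norm_smul, Real.norm_eq_abs, abs_of_pos l0]; gcongr
    · refine hp_norm4 _ _ _ _ _ ?_ ?_ ?_ n4 <;> simpa using hn
  have t1' : ‖(1 / l) • fderiv ℝ f (l * ω, l ^ 2 * ε, x, l • y) (l * u, 0, v, 0)‖ ≤ M * (l * r) * n := by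
    rw [norm_smul, Real.norm_eq_abs, abs_of_pos (by positivity)]
    calc _ ≤ (1 / l) * (M * (l ^ 2 * r) * n) := by gcongr; exact t1.trans (by gcongr)
      _ = _ := by field_simp
  refine (norm_add_le _ _).trans ?_
  have := norm_add_le ((1 / l) • fderiv ℝ f (l * ω, l ^ 2 * ε, x, l • y) (l * u, 0, v, 0))
    (fderiv ℝ f (l * ω, l ^ 2 * ε, x, l • y) (0, l * e, 0, 0))
  have p1 : 0 ≤ l * M * n := by positivity
  have p2 : 0 ≤ l * M * n * r := by positivity
  have p3 : 0 ≤ l * M * n * r ^ 2 := by positivity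
  nlinarith
end est

/-- reassociation -/
noncomputable def hpE (X V : Type*) [NormedAddCommGroup X] [NormedSpace ℝ X]
  [NormedAddCommGroup V] [NormedSpace ℝ V] : ((ℝ × ℝ × X) × V) →L[ℝ] (ℝ × ℝ × X × V) :=
  (((ContinuousLinearMap.fst ℝ ℝ (ℝ × X)).comp (ContinuousLinearMap.fst ℝ (ℝ × ℝ × X) V))).prod
  (((ContinuousLinearMap.fst ℝ ℝ X).comp ((ContinuousLinearMap.snd ℝ ℝ (ℝ × X)).comp
    (ContinuousLinearMap.fst ℝ (ℝ × ℝ × X) V))).prod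
  (((ContinuousLinearMap.snd ℝ ℝ X).comp ((ContinuousLinearMap.snd ℝ ℝ (ℝ × X)).comp
    (ContinuousLinearMap.fst ℝ (ℝ × ℝ × X) V))).prod (ContinuousLinearMap.snd ℝ (ℝ × ℝ × X) V)))

theorem hpE_apply {X V : Type*} [NormedAddCommGroup X] [NormedSpace ℝ X]
  [NormedAddCommGroup V] [NormedSpace ℝ V] (p : (ℝ × ℝ × X) × V) :
    hpE X V p = (p.1.1, p.1.2.1, p.1.2.2, p.2) := rfl

theorem hpE_norm {X V : Type*} [NormedAddCommGroup X] [NormedSpace ℝ X]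
  [NormedAddCommGroup V] [NormedSpace ℝ V] (p : (ℝ × ℝ × X) × V) :
    ‖hpE X V p‖ ≤ ‖p‖ := by
  obtain ⟨⟨u, e, v⟩, w⟩ := p
  rw [hpE_apply]
  simp only [Prod.norm_mk, max_assoc]
  exact le_rfl

theorem hp_bounds {X V F : Type*} [NormedAddCommGroup X] [NormedSpace ℝ X]
  [NormedAddCommGroup V] [NormedSpace ℝ V] [NormedAddCommGroup F] [NormedSpace ℝ F]
    (f : ℝ × ℝ × X × V → F) (cf : ContDiff ℝ 2 f) (C M : ℝ)
    (h : ∀ p ∈ hpR X V C C, ∀ i : ℕ, i ≤ 2 → ‖iteratedFDeriv ℝ i f p‖ ≤ M) :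
    (∀ p ∈ hpR X V C C, ‖fderiv ℝ f p‖ ≤ M) ∧
    (∀ p ∈ hpR X V C C, ∀ p' ∈ hpR X V C C, ‖fderiv ℝ f p - fderiv ℝ f p'‖ ≤ M * ‖p - p'‖) := by
  constructor
  · intro p hp
    have := h p hp 1 (by norm_num)
    rwa [norm_iteratedFDeriv_one] at this
  · intro p hp p' hp'
    have cd : ContDiff ℝ 1 (fderiv ℝ f) := cf.fderiv_right (by norm_num)
    refine (hpR_convex C C).norm_image_sub_le_of_norm_fderiv_le
      (fun x _ => cd.differentiable one_ne_zero x) (fun x hx => ?_) hp' hp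
    have := h x hx 2 le_rfl
    rwa [← norm_iteratedFDeriv_fderiv, norm_iteratedFDeriv_one] at this

theorem hp_Glam_apply {k₁ k₂ : ℕ} (α : ℝ → ℝ → Euc k₁ → Euc k₂ → Euc k₁)
    (β : ℝ → ℝ → Euc k₁ → Euc k₂ → Euc k₂) (Ψ : ℝ → ℝ → Euc k₂ → ℝ) (l : ℝ)
    (a : (ℝ × ℝ × Euc k₁) × Euc k₂ → ℝ × ℝ × Euc k₁) (b : (ℝ × ℝ × Euc k₁) × Euc k₂ → Euc k₂)
    (hG : ∀ p, Glam α β Ψ l (hpE _ _ p) = hpE _ _ (p.1 + a p, b p))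
    (ψ : ℝ × ℝ × Euc k₁ → Euc k₂) :
    (Glam α β Ψ l '' GphT ψ = GphT ψ → ∀ z, ψ (z + a (z, ψ z)) = b (z, ψ z)) ∧
    ((∀ z, ψ (z + a (z, ψ z)) = b (z, ψ z)) → (∀ w, ∃ z, z + a (z, ψ z) = w) →
      Glam α β Ψ l '' GphT ψ = GphT ψ) := by
  have hE : ∀ z y, hpE (Euc k₁) (Euc k₂) (z, y) ∈ GphT ψ ↔ y = ψ z := fun z y => Iff.rfl
  have hs : ∀ p : ℝ × ℝ × Euc k₁ × Euc k₂, ∃ z y, p = hpE _ _ (z, y) := fun p =>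
    ⟨(p.1, p.2.1, p.2.2.1), p.2.2.2, rfl⟩
  constructor
  · intro h z
    have m : Glam α β Ψ l (hpE _ _ (z, ψ z)) ∈ GphT ψ := by
      rw [← h]; exact mem_image_of_mem _ ((hE _ _).2 rfl)
    rw [hG, hE] at m
    exact m.symm
  · intro h1 h2
    apply Subset.antisymm
    · rintro _ ⟨p, hp, rfl⟩
      obtain ⟨z, y, rfl⟩ := hs p
      rw [hE] at hp
      rw [hG, hE, hp]
      exact (h1 z).symm
    · intro p hp
      obtain ⟨w, y, rfl⟩ := hs p
      rw [hE] at hp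
      obtain ⟨z, rfl⟩ := h2 w
      refine ⟨hpE _ _ (z, ψ z), (hE _ _).2 rfl, ?_⟩
      rw [hG, hp, h1]

set_option maxHeartbeats 2000000

/-- Corollary 2.5 (Hadamard–Perron applied to `G_λ`): existence of a unique invariant
`1`-Lipschitz `C¹` graph for `G_λ`. -/
theorem stmt4 (k₁ k₂ : ℕ) (r₁ : ℝ) (hr₁ : 0 < r₁)
    (α : ℝ → ℝ → Euc k₁ → Euc k₂ → Euc k₁)
    (β : ℝ → ℝ → Euc k₁ → Euc k₂ → Euc k₂)
    (hαC2 : ContDiff ℝ 2 (fun p : ℝ × ℝ × Euc k₁ × Euc k₂ => α p.1 p.2.1 p.2.2.1 p.2.2.2))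
    (hβC2 : ContDiff ℝ 2 (fun p : ℝ × ℝ × Euc k₁ × Euc k₂ => β p.1 p.2.1 p.2.2.1 p.2.2.2))
    (hA1 : ∀ C : ℝ, ∃ M : ℝ, ∀ (ω ε : ℝ) (x : Euc k₁) (y : Euc k₂),
      |ω| ≤ C → |ε| ≤ C → ‖y‖ ≤ C → ∀ i : ℕ, i ≤ 2 →
        ‖iteratedFDeriv ℝ i (fun p : ℝ × ℝ × Euc k₁ × Euc k₂ => α p.1 p.2.1 p.2.2.1 p.2.2.2)
            (ω, ε, x, y)‖ ≤ M ∧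
        ‖iteratedFDeriv ℝ i (fun p : ℝ × ℝ × Euc k₁ × Euc k₂ => β p.1 p.2.1 p.2.2.1 p.2.2.2)
            (ω, ε, x, y)‖ ≤ M)
    (hA2α : ∀ (ω ω' : ℝ) (x x' : Euc k₁) (y : Euc k₂), α ω 0 x y = α ω' 0 x' y)
    (hA2β : ∀ (ω ω' : ℝ) (x x' : Euc k₁) (y : Euc k₂), β ω 0 x y = β ω' 0 x' y)
    (hA20 : β 0 0 0 0 = 0)
    (hA3inv : ∃ Beq : Euc k₂ ≃L[ℝ] Euc k₂,
      (Beq : Euc k₂ →L[ℝ] Euc k₂) = fderiv ℝ (fun y : Euc k₂ => β 0 0 0 y) 0)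
    (q : ℝ) (hq0 : 0 ≤ q) (hq1 : q < 1)
    (hA3q : ∀ y₁ y₂ : Euc k₂, ‖y₁‖ ≤ r₁ → ‖y₂‖ ≤ r₁ →
      ‖β 0 0 0 y₁ - β 0 0 0 y₂‖ ≤ q * ‖y₁ - y₂‖)
    (Ψ : ℝ → ℝ → Euc k₂ → ℝ)
    (hΨC1 : ContDiff ℝ 1 (fun p : ℝ × ℝ × Euc k₂ => Ψ p.1 p.2.1 p.2.2))
    (hΨ01 : ∀ (ω ε : ℝ) (y : Euc k₂), Ψ ω ε y ∈ Icc (0:ℝ) 1)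
    (hΨ1 : ∀ (ω ε : ℝ) (y : Euc k₂),
      ω ∈ Icc (0:ℝ) 1 → ε ∈ Ioo (-(r₁ / 2)) (r₁ / 2) → ‖y‖ ≤ r₁ / 2 → Ψ ω ε y = 1)
    (hΨ0 : ∀ (ω ε : ℝ) (y : Euc k₂),
      ¬(ω ∈ Icc (-1:ℝ) 2 ∧ ε ∈ Ioo (-r₁) r₁ ∧ ‖y‖ ≤ r₁) → Ψ ω ε y = 0) :
    ∃ l₀ : ℝ, 0 < l₀ ∧ l₀ ≤ 1 ∧ ∀ l : ℝ, 0 < l → l ≤ l₀ →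
      ∃ ψ : ℝ × ℝ × Euc k₁ → Euc k₂,
        (ContDiff ℝ 1 ψ ∧ Glam α β Ψ l '' GphT ψ = GphT ψ ∧
          ∀ p : ℝ × ℝ × Euc k₁, ‖fderiv ℝ ψ p‖ ≤ 1) ∧
        ∀ ψ' : ℝ × ℝ × Euc k₁ → Euc k₂,
          ContDiff ℝ 1 ψ' → Glam α β Ψ l '' GphT ψ' = GphT ψ' →
          (∀ p : ℝ × ℝ × Euc k₁, ‖fderiv ℝ ψ' p‖ ≤ 1) → ψ' = ψ := by
  set fα : ℝ × ℝ × Euc k₁ × Euc k₂ → Euc k₁ := fun p => α p.1 p.2.1 p.2.2.1 p.2.2.2 with hfα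
  set fβ : ℝ × ℝ × Euc k₁ × Euc k₂ → Euc k₂ := fun p => β p.1 p.2.1 p.2.2.1 p.2.2.2 with hfβ
  set C := max 2 r₁ with hC
  have h2C : 2 ≤ C := le_max_left _ _
  have hrC : r₁ ≤ C := le_max_right _ _
  obtain ⟨M, hM⟩ := hA1 C
  have hM0 : 0 ≤ M := (norm_nonneg _).trans
    (hM 0 0 0 0 (by simp; linarith) (by simp; linarith) (by simp; linarith) 0 (by norm_num)).1
  obtain ⟨α1, α2⟩ := hp_bounds fα hαC2 C M
    (fun p hp i hi => (hM p.1 p.2.1 p.2.2.1 p.2.2.2 hp.1 hp.2.1 hp.2.2 i hi).1)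
  obtain ⟨β1, β2⟩ := hp_bounds fβ hβC2 C M
    (fun p hp i hi => (hM p.1 p.2.1 p.2.2.1 p.2.2.2 hp.1 hp.2.1 hp.2.2 i hi).2)
  have dα : Differentiable ℝ fα := hαC2.differentiable two_ne_zero
  have dβ : Differentiable ℝ fβ := hβC2.differentiable two_ne_zero
  -- bound on the derivative of the cutoff
  set Ψ' : ℝ × ℝ × Euc k₂ → ℝ := fun p => Ψ p.1 p.2.1 p.2.2 with hΨ'
  have dΨ : Differentiable ℝ Ψ' := hΨC1.differentiable one_ne_zero
  obtain ⟨D, hD⟩ : ∃ D, ∀ p, ‖fderiv ℝ Ψ' p‖ ≤ D := by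
    have hcs : HasCompactSupport Ψ' := by
      refine HasCompactSupport.intro (K := Icc (-1:ℝ) 2 ×ˢ Icc (-r₁) r₁ ×ˢ
        Metric.closedBall (0 : Euc k₂) r₁)
        (isCompact_Icc.prod (isCompact_Icc.prod (isCompact_closedBall _ _))) ?_
      intro p hp
      refine hΨ0 _ _ _ fun h => hp ?_
      exact ⟨h.1, ⟨h.2.1.1.le, h.2.1.2.le⟩, by simpa using h.2.2⟩
    exact (hΨC1.continuous_fderiv one_ne_zero).bounded_above_of_compact_support (hcs.fderiv (𝕜 := ℝ))
  have hD0 : 0 ≤ D := (norm_nonneg _).trans (hD 0)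
  set B := fderiv ℝ (fun y : Euc k₂ => β 0 0 0 y) 0 with hB
  have hBq : ‖B‖ ≤ q := by
    have dB : DifferentiableAt ℝ (fun y : Euc k₂ => β 0 0 0 y) 0 := by
      have : Differentiable ℝ (fun y : Euc k₂ => fβ (0, 0, 0, y)) := by fun_prop
      exact this 0
    refine dB.hasFDerivAt.le_of_lip' hq0 ?_
    filter_upwards [Metric.closedBall_mem_nhds (0 : Euc k₂) hr₁] with y hy
    exact hA3q y 0 (by simpa using hy) (by simpa using hr₁.le)
  set c0 := M * (r₁ + 1) * (r₁ + 2) with hc0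
  have hc00 : 0 ≤ c0 := by positivity
  set E := c0 * (1 + r₁ * D) + ‖α 0 0 0 0‖ + 1 with hE
  have hE0 : 0 < E := by positivity
  refine ⟨min 1 ((1 - q) / (4 * E)), lt_min one_pos (div_pos (by linarith) (by positivity)),
    min_le_left _ _, fun l l0 ll => ?_⟩
  have l1 : l ≤ 1 := ll.trans (min_le_left _ _)
  have lE : l * (4 * E) ≤ 1 - q := by
    rw [← le_div_iff₀ (by positivity)]; exact ll.trans (min_le_right _ _)
  -- the cutoff on the big space
  let T : (ℝ × ℝ × Euc k₁ × Euc k₂) →L[ℝ] (ℝ × ℝ × Euc k₂) :=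
    (l • ContinuousLinearMap.id ℝ ℝ).prodMap ((ContinuousLinearMap.id ℝ ℝ).prodMap
      (ContinuousLinearMap.snd ℝ (Euc k₁) (Euc k₂)))
  have hT : ∀ p, T p = (l * p.1, p.2.1, p.2.2.2) := fun p => rfl
  have hTn : ‖T‖ ≤ 1 := by
    refine ContinuousLinearMap.opNorm_le_bound _ zero_le_one fun p => ?_
    obtain ⟨ω, ε, x, y⟩ := p
    obtain ⟨n1, n2, n3, n4⟩ := hp_norm4' ω ε x y
    rw [hT, one_mul, Prod.norm_mk, Prod.norm_mk]
    refine max_le ?_ (max_le n2 n4)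
    rw [Real.norm_eq_abs, abs_mul, abs_of_pos l0]
    nlinarith [abs_nonneg ω]
  let χ : ℝ × ℝ × Euc k₁ × Euc k₂ → ℝ := fun p => Ψ' (T p)
  have hχe : ∀ p, χ p = Ψ (l * p.1) p.2.1 p.2.2.2 := fun p => by simp only [χ, hT, hΨ']
  have cχ : ContDiff ℝ 1 χ := hΨC1.comp T.contDiff
  have dχ : Differentiable ℝ χ := cχ.differentiable one_ne_zero
  have hDχ : ∀ p, ‖fderiv ℝ χ p‖ ≤ D := by
    intro p
    have : HasFDerivAt χ ((fderiv ℝ Ψ' (T p)).comp T) p :=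
      (dΨ (T p)).hasFDerivAt.comp p T.hasFDerivAt
    rw [this.fderiv]
    refine (ContinuousLinearMap.opNorm_comp_le _ _).trans ?_
    calc _ ≤ D * 1 := by gcongr; exact hD _
      _ = D := mul_one D
  have χ0 : ∀ p, 0 ≤ χ p := fun p => by rw [hχe]; exact (hΨ01 _ _ _).1
  have χ1 : ∀ p, χ p ≤ 1 := fun p => by rw [hχe]; exact (hΨ01 _ _ _).2
  have χz : ∀ p, p ∉ hpR (Euc k₁) (Euc k₂) (2 / l) r₁ → χ p = 0 := by
    intro p hp
    rw [hχe]
    refine hΨ0 _ _ _ fun h => hp ⟨?_, ?_, h.2.2⟩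
    · rw [le_div_iff₀ l0]
      have : |l * p.1| ≤ 2 := abs_le.2 ⟨by linarith [h.1.1], h.1.2⟩
      rw [abs_mul, abs_of_pos l0] at this; linarith
    · exact abs_le.2 ⟨h.2.1.1.le, h.2.1.2.le⟩
  -- perturbations
  let gα : ℝ × ℝ × Euc k₁ × Euc k₂ → Euc k₁ := fun p => (l * p.1) • (fα (hpS _ _ l p) - fα 0)
  let gβ : ℝ × ℝ × Euc k₁ × Euc k₂ → Euc k₂ := fun p => (1 / l) • fβ (hpS _ _ l p) -
      fderiv ℝ (fun y => fβ (0, 0, 0, y)) 0 p.2.2.2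
  have cgα : ContDiff ℝ 1 gα := by
    have h1 : ContDiff ℝ 1 fα := hαC2.of_le (by norm_num)
    exact (contDiff_const.mul contDiff_fst).smul ((h1.comp (hpS _ _ l).contDiff).sub contDiff_const)
  have cgβ : ContDiff ℝ 1 gβ := by
    have h1 : ContDiff ℝ 1 fβ := hβC2.of_le (by norm_num)
    refine ((h1.comp (hpS _ _ l).contDiff).const_smul (1 / l)).sub ?_
    have h2 : ContDiff ℝ 1 (fun p : ℝ × ℝ × Euc k₁ × Euc k₂ => p.2.2.2) := by fun_prop
    exact (ContinuousLinearMap.contDiff _).comp h2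
  have Kα := hp_cut gα (cgα.differentiable one_ne_zero) (2 / l) r₁ (l * c0) D hr₁.le (by positivity)
    (hp_alpha fα dα (fun ω ω' x x' y => hA2α ω ω' x x' y) C M r₁ l h2C hrC hr₁.le hM0 l0 l1 α1 α2)
    (fun ω x => by
      simp only [gα, hpS_apply, mul_zero, smul_zero, hfα]
      rw [hA2α _ 0 _ 0]; exact smul_eq_zero_of_right _ (sub_self _))
    χ dχ χ0 χ1 χz hDχ
  have Kβ := hp_cut gβ (cgβ.differentiable one_ne_zero) (2 / l) r₁ (l * c0) D hr₁.le (by positivity)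
    (hp_beta fβ dβ (fun ω ω' x x' y => hA2β ω ω' x x' y) C M r₁ l h2C hrC hr₁.le hM0 l0 l1 β1 β2)
    (fun ω x => by
      simp only [gβ, hpS_apply, mul_zero, smul_zero, hfβ, map_zero, sub_zero]
      rw [hA2β _ 0 _ 0, hA20, smul_zero])
    χ dχ χ0 χ1 χz hDχ
  let ι : Euc k₁ →L[ℝ] ℝ × ℝ × Euc k₁ :=
    (ContinuousLinearMap.inr ℝ ℝ (ℝ × Euc k₁)).comp (ContinuousLinearMap.inr ℝ ℝ (Euc k₁))
  have hι : ∀ x, ι x = (0, 0, x) := fun x => rfl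
  have hιn : ∀ x, ‖ι x‖ ≤ ‖x‖ := fun x => by rw [hι]; simp [Prod.norm_mk]
  let sh : ((ℝ × ℝ × Euc k₁) × Euc k₂) →L[ℝ] Euc k₁ :=
    ((l • ContinuousLinearMap.fst ℝ ℝ (ℝ × Euc k₁ × Euc k₂)).smulRight (α 0 0 0 0)).comp (hpE _ _)
  have hsh : ∀ p, sh p = (l * p.1.1) • α 0 0 0 0 := fun p => by
    simp [sh, hpE_apply]
  let a : (ℝ × ℝ × Euc k₁) × Euc k₂ → ℝ × ℝ × Euc k₁ := fun p =>
    ι (sh p + χ (hpE _ _ p) • gα (hpE _ _ p))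
  let b : (ℝ × ℝ × Euc k₁) × Euc k₂ → Euc k₂ := fun p =>
    B p.2 + χ (hpE _ _ p) • gβ (hpE _ _ p)
  have cα : ContDiff ℝ 1 (fun p => χ p • gα p) := cχ.smul cgα
  have cβ : ContDiff ℝ 1 (fun p => χ p • gβ p) := cχ.smul cgβ
  have cE : ContDiff ℝ 1 (hpE (Euc k₁) (Euc k₂)) := (hpE (Euc k₁) (Euc k₂)).contDiff
  have ca : ContDiff ℝ 1 a :=
    ι.contDiff.comp (sh.contDiff.add (cα.comp cE))
  have cb : ContDiff ℝ 1 b :=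
    (B.contDiff.comp contDiff_snd).add (cβ.comp cE)
  have lE1 : l * c0 * (1 + r₁ * D) + l * ‖α 0 0 0 0‖ ≤ l * E := by
    rw [hE]; nlinarith
  have lE2 : l * c0 * (1 + r₁ * D) ≤ l * E := by
    have : 0 ≤ l * ‖α 0 0 0 0‖ := by positivity
    linarith
  have hAb : ∀ p v, ‖fderiv ℝ a p v‖ ≤ l * E * ‖v‖ := by
    intro p v
    have h : HasFDerivAt a (ι.comp (sh + (fderiv ℝ (fun p => χ p • gα p) (hpE _ _ p)).comp
        (hpE _ _))) p :=
      ι.hasFDerivAt.comp p (sh.hasFDerivAt.add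
        ((cα.differentiable one_ne_zero _).hasFDerivAt.comp p (hpE (Euc k₁) (Euc k₂)).hasFDerivAt))
    rw [h.fderiv]
    refine (hιn (sh v + fderiv ℝ (fun p => χ p • gα p) (hpE _ _ p) (hpE _ _ v))).trans ?_
    refine (norm_add_le _ _).trans ?_
    have e1 : ‖sh v‖ ≤ l * ‖α 0 0 0 0‖ * ‖v‖ := by
      rw [hsh, norm_smul, norm_mul, Real.norm_eq_abs, abs_of_pos l0]
      have : ‖v.1.1‖ ≤ ‖v‖ := (norm_fst_le v.1).trans (norm_fst_le v)
      calc _ ≤ l * ‖v‖ * ‖α 0 0 0 0‖ := by gcongr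
        _ = _ := by ring
    have e2 : ‖fderiv ℝ (fun p => χ p • gα p) (hpE _ _ p) (hpE _ _ v)‖ ≤
        l * c0 * (1 + r₁ * D) * ‖v‖ := by
      refine (ContinuousLinearMap.le_of_opNorm_le _ (Kα _).1 _).trans ?_
      gcongr
      exact hpE_norm v
    have e3 := mul_le_mul_of_nonneg_right lE1 (norm_nonneg v)
    linarith
  have hBb : ∀ p u v, ‖fderiv ℝ b p (u, v)‖ ≤ l * E * ‖u‖ + (q + l * E) * ‖v‖ := by
    intro p u v
    have h : HasFDerivAt b (B.comp (ContinuousLinearMap.snd ℝ (ℝ × ℝ × Euc k₁) (Euc k₂)) +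
        (fderiv ℝ (fun p => χ p • gβ p) (hpE _ _ p)).comp (hpE _ _)) p :=
      (B.hasFDerivAt.comp p hasFDerivAt_snd).add
        ((cβ.differentiable one_ne_zero _).hasFDerivAt.comp p (hpE (Euc k₁) (Euc k₂)).hasFDerivAt)
    rw [h.fderiv, add_apply]
    refine (norm_add_le _ _).trans ?_
    have e1 : ‖B v‖ ≤ q * ‖v‖ := ContinuousLinearMap.le_of_opNorm_le _ hBq _
    have e2 : ‖fderiv ℝ (fun p => χ p • gβ p) (hpE _ _ p) (hpE _ _ (u, v))‖ ≤
        l * E * (‖u‖ + ‖v‖) := by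
      refine (ContinuousLinearMap.le_of_opNorm_le _ (Kβ _).1 _).trans ?_
      gcongr
      refine (hpE_norm (u, v)).trans ?_
      rw [Prod.norm_mk]
      exact max_le (by linarith [norm_nonneg v]) (by linarith [norm_nonneg u])
    rw [ContinuousLinearMap.comp_apply, ContinuousLinearMap.comp_apply]
    show ‖B v‖ + _ ≤ _
    linarith
  have hK : ∀ z, ‖b (z, 0)‖ ≤ l * c0 * r₁ := by
    intro z
    have := (Kβ (hpE _ _ (z, 0))).2
    simpa only [b, map_zero, zero_add] using this
  have hG : ∀ p, Glam α β Ψ l (hpE _ _ p) = hpE _ _ (p.1 + a p, b p) := by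
    rintro ⟨⟨ω, ε, x⟩, y⟩
    simp only [Glam, tAl, tBl, a, b, hι, hsh, hpE_apply, hχe, gα, gβ, hpS_apply, hfα, hfβ, hB]
    simp [add_assoc]
  obtain ⟨ψ, ⟨p1, p2, p3, p4⟩, p5⟩ := hp_main a b ca cb (l * E) (q + l * E) _ (by positivity)
    (by positivity) (by nlinarith [mul_pos l0 hE0]) hAb hBb hK
  refine ⟨ψ, ⟨p1, (hp_Glam_apply α β Ψ l a b hG ψ).2 p2 p3, p4⟩, fun ψ' c' i' n' => ?_⟩
  exact p5 ψ' c' ((hp_Glam_apply α β Ψ l a b hG ψ').1 i') n'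
end

section
/- (Lemma 2.7) Under assumptions (A1)–(A3) there exists λ₀ ∈ (0,1] such that for every λ ∈ (0,λ₀]: if φ ∈ C¹(ℝ^{k₁}, ℝ^{k₂}) satisfies G_λ({(0,0,x,φ(x)) : x ∈ ℝ^{k₁}}) = {(0,0,x,φ(x)) : x ∈ ℝ^{k₁}}, then φ ≡ 0. -/
open Set

/-- Lemma 2.7: the only `C¹` curve whose `(0,0)`-slice is invariant under `G_λ` is `0`. -/
theorem stmt6 (k₁ k₂ : ℕ) (r₁ : ℝ) (hr₁ : 0 < r₁)
    (α : ℝ → ℝ → Euc k₁ → Euc k₂ → Euc k₁)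
    (β : ℝ → ℝ → Euc k₁ → Euc k₂ → Euc k₂)
    (hαC2 : ContDiff ℝ 2 (fun p : ℝ × ℝ × Euc k₁ × Euc k₂ => α p.1 p.2.1 p.2.2.1 p.2.2.2))
    (hβC2 : ContDiff ℝ 2 (fun p : ℝ × ℝ × Euc k₁ × Euc k₂ => β p.1 p.2.1 p.2.2.1 p.2.2.2))
    (hA1 : ∀ C : ℝ, ∃ M : ℝ, ∀ (ω ε : ℝ) (x : Euc k₁) (y : Euc k₂),
      |ω| ≤ C → |ε| ≤ C → ‖y‖ ≤ C → ∀ i : ℕ, i ≤ 2 →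
        ‖iteratedFDeriv ℝ i (fun p : ℝ × ℝ × Euc k₁ × Euc k₂ => α p.1 p.2.1 p.2.2.1 p.2.2.2)
            (ω, ε, x, y)‖ ≤ M ∧
        ‖iteratedFDeriv ℝ i (fun p : ℝ × ℝ × Euc k₁ × Euc k₂ => β p.1 p.2.1 p.2.2.1 p.2.2.2)
            (ω, ε, x, y)‖ ≤ M)
    (hA2α : ∀ (ω ω' : ℝ) (x x' : Euc k₁) (y : Euc k₂), α ω 0 x y = α ω' 0 x' y)
    (hA2β : ∀ (ω ω' : ℝ) (x x' : Euc k₁) (y : Euc k₂), β ω 0 x y = β ω' 0 x' y)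
    (hA20 : β 0 0 0 0 = 0)
    (hA3inv : ∃ Beq : Euc k₂ ≃L[ℝ] Euc k₂,
      (Beq : Euc k₂ →L[ℝ] Euc k₂) = fderiv ℝ (fun y : Euc k₂ => β 0 0 0 y) 0)
    (q : ℝ) (hq0 : 0 ≤ q) (hq1 : q < 1)
    (hA3q : ∀ y₁ y₂ : Euc k₂, ‖y₁‖ ≤ r₁ → ‖y₂‖ ≤ r₁ →
      ‖β 0 0 0 y₁ - β 0 0 0 y₂‖ ≤ q * ‖y₁ - y₂‖)
    (Ψ : ℝ → ℝ → Euc k₂ → ℝ)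
    (hΨC1 : ContDiff ℝ 1 (fun p : ℝ × ℝ × Euc k₂ => Ψ p.1 p.2.1 p.2.2))
    (hΨ01 : ∀ (ω ε : ℝ) (y : Euc k₂), Ψ ω ε y ∈ Icc (0:ℝ) 1)
    (hΨ1 : ∀ (ω ε : ℝ) (y : Euc k₂),
      ω ∈ Icc (0:ℝ) 1 → ε ∈ Ioo (-(r₁ / 2)) (r₁ / 2) → ‖y‖ ≤ r₁ / 2 → Ψ ω ε y = 1)
    (hΨ0 : ∀ (ω ε : ℝ) (y : Euc k₂),
      ¬(ω ∈ Icc (-1:ℝ) 2 ∧ ε ∈ Ioo (-r₁) r₁ ∧ ‖y‖ ≤ r₁) → Ψ ω ε y = 0) :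
    ∃ l₀ : ℝ, 0 < l₀ ∧ l₀ ≤ 1 ∧ ∀ l : ℝ, 0 < l → l ≤ l₀ →
      ∀ φ : Euc k₁ → Euc k₂, ContDiff ℝ 1 φ →
        Glam α β Ψ l ''
            {p : ℝ × ℝ × Euc k₁ × Euc k₂ | p.1 = 0 ∧ p.2.1 = 0 ∧ p.2.2.2 = φ p.2.2.1} =
          {p : ℝ × ℝ × Euc k₁ × Euc k₂ | p.1 = 0 ∧ p.2.1 = 0 ∧ p.2.2.2 = φ p.2.2.1} →
        ∀ x : Euc k₁, φ x = 0 := by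
  have hB : ‖fderiv ℝ (fun y : Euc k₂ => β 0 0 0 y) 0‖ ≤ q := by
    apply norm_fderiv_le_of_lip' ℝ hq0
    filter_upwards [Metric.ball_mem_nhds (0 : Euc k₂) hr₁] with y hy
    exact hA3q y 0 (by simpa using (mem_ball_zero_iff.1 hy).le) (by simpa using hr₁.le)
  refine ⟨1, one_pos, le_rfl, ?_⟩
  intro l hl hl1 φ _ hinv x
  have hmem : Glam α β Ψ l (0, 0, x, φ x) ∈
      {p : ℝ × ℝ × Euc k₁ × Euc k₂ | p.1 = 0 ∧ p.2.1 = 0 ∧ p.2.2.2 = φ p.2.2.1} := by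
    rw [← hinv]
    exact ⟨(0, 0, x, φ x), ⟨rfl, rfl, rfl⟩, rfl⟩
  have hfix := hmem.2.2
  simp only [Glam, tAl, tBl, mul_zero, zero_smul, smul_zero, add_zero] at hfix
  generalize φ x = y at hfix
  rw [hA2β 0 0 x 0] at hfix
  have hBy : ‖fderiv ℝ (fun y : Euc k₂ => β 0 0 0 y) 0 y‖ ≤ q * ‖y‖ :=
    ContinuousLinearMap.le_of_opNorm_le _ hB y
  generalize fderiv ℝ (fun y : Euc k₂ => β 0 0 0 y) 0 y = b at hfix hBy
  have key : ‖y‖ ≤ q * ‖y‖ := by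
    by_cases hy : ‖y‖ ≤ r₁
    · have hly : ‖l • y‖ ≤ l * ‖y‖ := by rw [norm_smul, Real.norm_of_nonneg hl.le]
      have h1 : ‖β 0 0 0 (l • y)‖ ≤ q * (l * ‖y‖) := by
        have h := hA3q (l • y) 0 (by nlinarith [norm_nonneg y]) (by simpa using hr₁.le)
        rw [hA20, sub_zero, sub_zero] at h
        exact h.trans (by gcongr)
      have hc : ‖(1 / l) • β 0 0 0 (l • y)‖ ≤ q * ‖y‖ := by
        rw [norm_smul, Real.norm_of_nonneg (by positivity), one_div, inv_mul_le_iff₀ hl]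
        linarith
      obtain ⟨h0, h1'⟩ := hΨ01 0 0 y
      generalize Ψ 0 0 y = t at *
      generalize (1 / l) • β 0 0 0 (l • y) = c at *
      have e : y = (1 - t) • b + t • c := by rw [← hfix]; module
      calc ‖y‖ = ‖(1 - t) • b + t • c‖ := by rw [← e]
        _ ≤ ‖(1 - t) • b‖ + ‖t • c‖ := norm_add_le _ _
        _ = (1 - t) * ‖b‖ + t * ‖c‖ := by
          rw [norm_smul, norm_smul, Real.norm_of_nonneg h0, Real.norm_of_nonneg (by linarith)]
        _ ≤ (1 - t) * (q * ‖y‖) + t * (q * ‖y‖) := by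
          have : 0 ≤ 1 - t := by linarith
          gcongr
        _ = q * ‖y‖ := by ring
    · rw [hΨ0 0 0 y (fun h => hy h.2.2), zero_smul, add_zero] at hfix
      rwa [hfix] at hBy
  have : ‖y‖ ≤ 0 := by
    by_contra! h
    nlinarith
  exact norm_le_zero_iff.1 this
end

section
/- (Corollary 2.8) Under assumptions (A1)–(A3) there exists λ₀ ∈ (0,1] such that for every λ ∈ (0,λ₀] the following holds: if ψ ∈ C¹(ℝ×ℝ×ℝ^{k₁}, ℝ^{k₂}) is 1-Lipschitz, satisfies G_λ(graph(ψ)) = graph(ψ), and satisfies ψ(0,0,x) = 0 for all x ∈ ℝ^{k₁}, then ψ(ω,0,x) = 0 for all ω ∈ ℝ and all x ∈ ℝ^{k₁}. -/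
open Set

/-- Corollary 2.8: a `1`-Lipschitz invariant graph vanishing at `(0,0,·)` vanishes
at `(ω,0,·)` for every `ω`. -/
theorem stmt7 (k₁ k₂ : ℕ) (r₁ : ℝ) (hr₁ : 0 < r₁)
    (α : ℝ → ℝ → Euc k₁ → Euc k₂ → Euc k₁)
    (β : ℝ → ℝ → Euc k₁ → Euc k₂ → Euc k₂)
    (hαC2 : ContDiff ℝ 2 (fun p : ℝ × ℝ × Euc k₁ × Euc k₂ => α p.1 p.2.1 p.2.2.1 p.2.2.2))
    (hβC2 : ContDiff ℝ 2 (fun p : ℝ × ℝ × Euc k₁ × Euc k₂ => β p.1 p.2.1 p.2.2.1 p.2.2.2))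
    (hA1 : ∀ C : ℝ, ∃ M : ℝ, ∀ (ω ε : ℝ) (x : Euc k₁) (y : Euc k₂),
      |ω| ≤ C → |ε| ≤ C → ‖y‖ ≤ C → ∀ i : ℕ, i ≤ 2 →
        ‖iteratedFDeriv ℝ i (fun p : ℝ × ℝ × Euc k₁ × Euc k₂ => α p.1 p.2.1 p.2.2.1 p.2.2.2)
            (ω, ε, x, y)‖ ≤ M ∧
        ‖iteratedFDeriv ℝ i (fun p : ℝ × ℝ × Euc k₁ × Euc k₂ => β p.1 p.2.1 p.2.2.1 p.2.2.2)
            (ω, ε, x, y)‖ ≤ M)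
    (hA2α : ∀ (ω ω' : ℝ) (x x' : Euc k₁) (y : Euc k₂), α ω 0 x y = α ω' 0 x' y)
    (hA2β : ∀ (ω ω' : ℝ) (x x' : Euc k₁) (y : Euc k₂), β ω 0 x y = β ω' 0 x' y)
    (hA20 : β 0 0 0 0 = 0)
    (hA3inv : ∃ Beq : Euc k₂ ≃L[ℝ] Euc k₂,
      (Beq : Euc k₂ →L[ℝ] Euc k₂) = fderiv ℝ (fun y : Euc k₂ => β 0 0 0 y) 0)
    (q : ℝ) (hq0 : 0 ≤ q) (hq1 : q < 1)
    (hA3q : ∀ y₁ y₂ : Euc k₂, ‖y₁‖ ≤ r₁ → ‖y₂‖ ≤ r₁ →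
      ‖β 0 0 0 y₁ - β 0 0 0 y₂‖ ≤ q * ‖y₁ - y₂‖)
    (Ψ : ℝ → ℝ → Euc k₂ → ℝ)
    (hΨC1 : ContDiff ℝ 1 (fun p : ℝ × ℝ × Euc k₂ => Ψ p.1 p.2.1 p.2.2))
    (hΨ01 : ∀ (ω ε : ℝ) (y : Euc k₂), Ψ ω ε y ∈ Icc (0:ℝ) 1)
    (hΨ1 : ∀ (ω ε : ℝ) (y : Euc k₂),
      ω ∈ Icc (0:ℝ) 1 → ε ∈ Ioo (-(r₁ / 2)) (r₁ / 2) → ‖y‖ ≤ r₁ / 2 → Ψ ω ε y = 1)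
    (hΨ0 : ∀ (ω ε : ℝ) (y : Euc k₂),
      ¬(ω ∈ Icc (-1:ℝ) 2 ∧ ε ∈ Ioo (-r₁) r₁ ∧ ‖y‖ ≤ r₁) → Ψ ω ε y = 0) :
    ∃ l₀ : ℝ, 0 < l₀ ∧ l₀ ≤ 1 ∧ ∀ l : ℝ, 0 < l → l ≤ l₀ →
      ∀ ψ : ℝ × ℝ × Euc k₁ → Euc k₂, ContDiff ℝ 1 ψ →
        (∀ p : ℝ × ℝ × Euc k₁, ‖fderiv ℝ ψ p‖ ≤ 1) →
        Glam α β Ψ l '' GphT ψ = GphT ψ →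
        (∀ x : Euc k₁, ψ (0, 0, x) = 0) →
        ∀ (ω : ℝ) (x : Euc k₁), ψ (ω, 0, x) = 0 := by
  have hB : ‖fderiv ℝ (fun y : Euc k₂ => β 0 0 0 y) 0‖ ≤ q := by
    apply norm_fderiv_le_of_lip' ℝ hq0
    filter_upwards [Metric.closedBall_mem_nhds (0 : Euc k₂) hr₁] with y hy
    exact hA3q y 0 (by simpa using hy) (by simpa using hr₁.le)
  refine ⟨1, one_pos, le_rfl, ?_⟩
  intro l hl hl1 ψ hψ hψL hG hψ0 ω
  have key : ∀ y : Euc k₂, ∀ x : Euc k₁,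
      ‖(Glam α β Ψ l (ω, 0, x, y)).2.2.2‖ ≤ q * ‖y‖ := by
    intro y x
    have hBy : ‖fderiv ℝ (fun y : Euc k₂ => β 0 0 0 y) 0 y‖ ≤ q * ‖y‖ :=
      ContinuousLinearMap.le_of_opNorm_le _ hB y
    simp only [Glam, tBl]
    set B := fderiv ℝ (fun y : Euc k₂ => β 0 0 0 y) 0 with hBdef
    by_cases hy : ‖y‖ ≤ r₁
    · have hly : ‖l • y‖ ≤ r₁ := by
        rw [norm_smul, Real.norm_of_nonneg hl.le]
        nlinarith [norm_nonneg y]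
      have h1 := hA3q (l • y) 0 hly (by simpa using hr₁.le)
      rw [hA20, sub_zero, sub_zero, norm_smul, Real.norm_of_nonneg hl.le] at h1
      have h2 : ‖(1 / l) • β (l * ω) (l ^ 2 * 0) x (l • y)‖ ≤ q * ‖y‖ := by
        rw [mul_zero, hA2β _ 0 x 0, norm_smul, Real.norm_of_nonneg (by positivity),
          one_div, inv_mul_le_iff₀ hl]
        linarith
      obtain ⟨p0, p1⟩ := hΨ01 (l * ω) 0 y
      set t := Ψ (l * ω) 0 y
      set v := (1 / l) • β (l * ω) (l ^ 2 * 0) x (l • y)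
      have e : B y + t • (v - B y) = (1 - t) • B y + t • v := by module
      rw [e]
      calc _ ≤ ‖(1 - t) • B y‖ + ‖t • v‖ := norm_add_le _ _
        _ = (1 - t) * ‖B y‖ + t * ‖v‖ := by
          rw [norm_smul, norm_smul, Real.norm_of_nonneg p0, Real.norm_of_nonneg (by linarith)]
        _ ≤ (1 - t) * (q * ‖y‖) + t * (q * ‖y‖) := by
          gcongr
        _ = q * ‖y‖ := by ring
    · rw [hΨ0 _ _ y (fun h => hy h.2.2), zero_smul, add_zero]
      exact hBy
  have step : ∀ n : ℕ, ∀ x : Euc k₁, ‖ψ (ω, 0, x)‖ ≤ q ^ n * |ω| := by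
    intro n
    induction n with
    | zero =>
      intro x
      have h := Convex.norm_image_sub_le_of_norm_fderiv_le (𝕜 := ℝ) (f := ψ) (C := 1)
        (s := univ) (x := ((0 : ℝ), (0 : ℝ), x)) (y := (ω, 0, x))
        (fun p _ => (hψ.differentiable (by norm_num)) p) (fun p _ => hψL p) convex_univ
        (mem_univ _) (mem_univ _)
      rw [hψ0] at h
      simpa [Prod.norm_def] using h
    | succ n ih =>
      intro x
      have hm : (ω, (0 : ℝ), x, ψ (ω, 0, x)) ∈ Glam α β Ψ l '' GphT ψ := by
        rw [hG]; rfl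
      obtain ⟨⟨ω', ε', x', y'⟩, hp, hpe⟩ := hm
      have e1 : ω' = ω := congrArg (fun p => p.1) hpe
      have e2 : ε' = 0 := congrArg (fun p => p.2.1) hpe
      subst e1 e2
      have e3 : y' = ψ (ω', 0, x') := hp
      have k := key y' x'
      rw [hpe] at k
      calc ‖ψ (ω', 0, x)‖ ≤ q * ‖y'‖ := k
        _ ≤ q * (q ^ n * |ω'|) := by
          rw [e3]
          gcongr
          exact ih x'
        _ = _ := by ring
  intro x
  have ht : Filter.Tendsto (fun n : ℕ => q ^ n * |ω|) Filter.atTop (nhds (0 * |ω|)) :=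
    (tendsto_pow_atTop_nhds_zero_of_lt_one hq0 hq1).mul_const _
  rw [zero_mul] at ht
  exact norm_le_zero_iff.1 (ge_of_tendsto' ht (fun n => step n x))
end

section
/- (Corollary 2.11) Let λ ∈ (0,1] and suppose ψ ∈ C¹(ℝ×ℝ×ℝ^{k₁}, ℝ^{k₂}) takes values in (r₁/2)𝔻^{k₂} and satisfies, for all ω' ∈ [0,1/λ] and ε' ∈ (−r₁/2,r₁/2), F_λ({(ω',ε',x,ψ(ω',ε',x)) : x ∈ ℝ^{k₁}}) = {(ω',ε',x,ψ(ω',ε',x)) : x ∈ ℝ^{k₁}}. Then for every ω ∈ [0,1] and every ε ∈ (−r₁λ²/2, r₁λ²/2), F₁({(ω,ε,x,λψ(ω/λ, ε/λ², x)) : x ∈ ℝ^{k₁}}) = {(ω,ε,x,λψ(ω/λ, ε/λ², x)) : x ∈ ℝ^{k₁}}. -/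
open Set

/-- `F_λ(ω,ε,x,y) = (A_λ(ω,ε,x) + tα_λ(ω,ε,x,y), By + tβ_λ(ω,ε,x,y))`, written componentwise
(the first two components of `A_λ(ω,ε,x)` are `ω` and `ε`, and `tα_λ` vanishes there). -/
noncomputable def Flam {k₁ k₂ : ℕ} (α : ℝ → ℝ → Euc k₁ → Euc k₂ → Euc k₁)
    (β : ℝ → ℝ → Euc k₁ → Euc k₂ → Euc k₂) (l : ℝ)
    (p : ℝ × ℝ × Euc k₁ × Euc k₂) : ℝ × ℝ × Euc k₁ × Euc k₂ :=
  (p.1, p.2.1, p.2.2.1 + (l * p.1) • α 0 0 0 0 + (tAl α l p).2.2,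
    fderiv ℝ (fun y : Euc k₂ => β 0 0 0 y) 0 p.2.2.2 + tBl β l p)

/-- The slice `{(ω,ε,x,ψ(ω,ε,x)) : x ∈ ℝ^{k₁}}` of the graph of `ψ` at fixed `(ω,ε)`. -/
def SliceT {k₁ k₂ : ℕ} (ψ : ℝ × ℝ × Euc k₁ → Euc k₂) (ω ε : ℝ) :
    Set (ℝ × ℝ × Euc k₁ × Euc k₂) :=
  {p | p.1 = ω ∧ p.2.1 = ε ∧ p.2.2.2 = ψ (ω, ε, p.2.2.1)}

/-- Corollary 2.11: rescaling `F_λ`-invariant slices of `ψ` produces `F₁`-invariant slices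
of `(ω,ε,x) ↦ λψ(ω/λ, ε/λ², x)`. -/
theorem stmt10 (k₁ k₂ : ℕ) (r₁ : ℝ) (hr₁ : 0 < r₁)
    (α : ℝ → ℝ → Euc k₁ → Euc k₂ → Euc k₁)
    (β : ℝ → ℝ → Euc k₁ → Euc k₂ → Euc k₂)
    (hαC2 : ContDiff ℝ 2 (fun p : ℝ × ℝ × Euc k₁ × Euc k₂ => α p.1 p.2.1 p.2.2.1 p.2.2.2))
    (hβC2 : ContDiff ℝ 2 (fun p : ℝ × ℝ × Euc k₁ × Euc k₂ => β p.1 p.2.1 p.2.2.1 p.2.2.2))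
    (l : ℝ) (hl0 : 0 < l) (hl1 : l ≤ 1)
    (ψ : ℝ × ℝ × Euc k₁ → Euc k₂) (hψC1 : ContDiff ℝ 1 ψ)
    (hψb : ∀ p : ℝ × ℝ × Euc k₁, ‖ψ p‖ ≤ r₁ / 2)
    (hslice : ∀ ω' ∈ Icc (0:ℝ) (1 / l), ∀ ε' ∈ Ioo (-(r₁ / 2)) (r₁ / 2),
      Flam α β l '' SliceT ψ ω' ε' = SliceT ψ ω' ε') :
    ∀ ω ∈ Icc (0:ℝ) 1, ∀ ε ∈ Ioo (-(r₁ * l ^ 2 / 2)) (r₁ * l ^ 2 / 2),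
      Flam α β 1 ''
          {p : ℝ × ℝ × Euc k₁ × Euc k₂ |
            p.1 = ω ∧ p.2.1 = ε ∧ p.2.2.2 = l • ψ (ω / l, ε / l ^ 2, p.2.2.1)} =
        {p : ℝ × ℝ × Euc k₁ × Euc k₂ |
          p.1 = ω ∧ p.2.1 = ε ∧ p.2.2.2 = l • ψ (ω / l, ε / l ^ 2, p.2.2.1)} := by
  intro ω hω ε hε
  have hl : l ≠ 0 := hl0.ne'
  let S : ℝ × ℝ × Euc k₁ × Euc k₂ → ℝ × ℝ × Euc k₁ × Euc k₂ :=
    fun p => (l * p.1, l ^ 2 * p.2.1, p.2.2.1, l • p.2.2.2)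
  have hconj : ∀ p, Flam α β 1 (S p) = S (Flam α β l p) := by
    rintro ⟨a, b, x, y⟩
    simp [S, Flam, tAl, tBl, smul_smul, hl]
  have hset : {p : ℝ × ℝ × Euc k₁ × Euc k₂ |
      p.1 = ω ∧ p.2.1 = ε ∧ p.2.2.2 = l • ψ (ω / l, ε / l ^ 2, p.2.2.1)} =
      S '' SliceT ψ (ω / l) (ε / l ^ 2) := by
    ext ⟨a, b, x, y⟩
    constructor
    · rintro ⟨h1, h2, h3⟩
      simp only at h1 h2 h3
      subst h1 h2 h3
      refine ⟨(a / l, b / l ^ 2, x, ψ (a / l, b / l ^ 2, x)), ⟨rfl, rfl, rfl⟩, ?_⟩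
      simp only [S]
      rw [mul_div_cancel₀ _ hl, mul_div_cancel₀ _ (pow_ne_zero 2 hl)]
    · rintro ⟨⟨a', b', x', y'⟩, ⟨h1, h2, h3⟩, h⟩
      simp only at h1 h2 h3
      subst h1 h2 h3
      simp only [S, Prod.mk.injEq] at h
      obtain ⟨rfl, rfl, rfl, rfl⟩ := h
      exact ⟨mul_div_cancel₀ _ hl, mul_div_cancel₀ _ (pow_ne_zero 2 hl), rfl⟩
  have hl2 : 0 < l ^ 2 := by positivity
  have hinv := hslice (ω / l) ⟨div_nonneg hω.1 hl0.le, by gcongr; exact hω.2⟩ (ε / l ^ 2)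
    ⟨by rw [lt_div_iff₀ hl2]; linarith [hε.1], by rw [div_lt_iff₀ hl2]; linarith [hε.2]⟩
  rw [hset, image_image]
  simp only [hconj]
  rw [← image_image S (Flam α β l), hinv]
end

section
/- (Lemma 2.12) Under assumptions (A1)–(A3) there exists λ₀ ∈ (0,1] such that for every λ ∈ (0,λ₀] the following holds. Let ψ ∈ C¹(ℝ×ℝ×ℝ^{k₁}, ℝ^{k₂}) be 1-Lipschitz with ‖ψ(ω,ε,x)‖ ≤ r₁/2 everywhere, whose slices are F_λ-invariant: F_λ({(ω,ε,x,ψ(ω,ε,x)) : x ∈ ℝ^{k₁}}) = {(ω,ε,x,ψ(ω,ε,x)) : x ∈ ℝ^{k₁}} for all ω ∈ [0,1/λ], ε ∈ (−r₁/2,r₁/2). Then for all such ω,ε and every initial condition (x₀,y₀) ∈ ℝ^{k₁}×(r₁/2)𝔻^{k₂}, the trajectory defined by (x_j,y_j) = [F_λ(ω,ε,x_{j−1},y_{j−1})]_{3−4} is defined for all j ∈ ℕ (in particular ‖y_j‖ ≤ r₁ for all j) and satisfies ‖y_j − ψ(ω,ε,x_j)‖ ≤ (q + 2(1−q)/3)^j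 · ‖y₀ − ψ(ω,ε,x₀)‖ for all j; in particular ‖y_j − ψ(ω,ε,x_j)‖ → 0 as j → ∞, uniformly with respect to (x₀,y₀). -/
open Set

/-- `[F_λ(ω,ε,x,y)]_{3-4}`, the last two components of `F_λ`, as a map of `(x,y)`. -/
noncomputable def Flam34 {k₁ k₂ : ℕ} (α : ℝ → ℝ → Euc k₁ → Euc k₂ → Euc k₁)
    (β : ℝ → ℝ → Euc k₁ → Euc k₂ → Euc k₂) (l ω ε : ℝ)
    (p : Euc k₁ × Euc k₂) : Euc k₁ × Euc k₂ :=
  ((Flam α β l (ω, ε, p.1, p.2)).2.2.1, (Flam α β l (ω, ε, p.1, p.2)).2.2.2)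

theorem aux_lip {E F : Type*} [NormedAddCommGroup E] [NormedSpace ℝ E] [NormedAddCommGroup F]
    [NormedSpace ℝ F] (f : E → F) (hf : ContDiff ℝ 2 f) (S : Set E) (hS : Convex ℝ S) (M : ℝ)
    (h1 : ∀ p ∈ S, ‖iteratedFDeriv ℝ 1 f p‖ ≤ M) :
    ∀ p ∈ S, ∀ p' ∈ S, ‖f p - f p'‖ ≤ M * ‖p - p'‖ := by
  intro p hp p' hp'
  refine hS.norm_image_sub_le_of_norm_fderiv_le (𝕜 := ℝ) (f := f) ?_ ?_ hp' hp
  · intro x _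
    exact (hf.differentiable (by norm_num)) x
  · intro x hx
    rw [← norm_iteratedFDeriv_one]
    exact h1 x hx

theorem aux_lip2 {E F : Type*} [NormedAddCommGroup E] [NormedSpace ℝ E] [NormedAddCommGroup F]
    [NormedSpace ℝ F] (f : E → F) (hf : ContDiff ℝ 2 f) (S : Set E) (hS : Convex ℝ S) (M : ℝ)
    (h2 : ∀ p ∈ S, ‖iteratedFDeriv ℝ 2 f p‖ ≤ M) (v : E) :
    ∀ p ∈ S, p + v ∈ S → ∀ p' ∈ S, p' + v ∈ S →
      ‖(f (p + v) - f p) - (f (p' + v) - f p')‖ ≤ M * ‖v‖ * ‖p - p'‖ := by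
  intro p hp hpv p' hp' hpv'
  have hd : Differentiable ℝ f := hf.differentiable (by norm_num)
  have hd' : Differentiable ℝ (fderiv ℝ f) :=
    (hf.fderiv_right (m := 1) (by norm_num)).differentiable (by norm_num)
  have hL : ∀ a ∈ S, ∀ b ∈ S, ‖fderiv ℝ f a - fderiv ℝ f b‖ ≤ M * ‖a - b‖ := by
    intro a ha b hb
    refine hS.norm_image_sub_le_of_norm_fderiv_le (𝕜 := ℝ) (f := fderiv ℝ f) ?_ ?_ hb ha
    · intro x _
      exact hd' x
    · intro x hx
      rw [← norm_iteratedFDeriv_one, norm_iteratedFDeriv_fderiv]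
      exact h2 x hx
  have hT : Convex ℝ (S ∩ (fun z => z + v) ⁻¹' S) := hS.inter (hS.translate_preimage_left v)
  refine hT.norm_image_sub_le_of_norm_hasFDerivWithin_le (𝕜 := ℝ) (f := fun z => f (z + v) - f z)
    (f' := fun z => fderiv ℝ f (z + v) - fderiv ℝ f z) ?_ ?_ ⟨hp', hpv'⟩ ⟨hp, hpv⟩
  · intro x _
    have : HasFDerivAt (fun z => f (z + v)) (fderiv ℝ f (x + v)) x :=
      (hasFDerivAt_comp_add_right v).2 (hd (x + v)).hasFDerivAt
    exact (this.sub (hd x).hasFDerivAt).hasFDerivWithinAt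
  · intro x hx
    have := hL _ hx.2 _ hx.1
    simpa using this

theorem aux_step (k₁ k₂ : ℕ) (r₁ : ℝ) (hr₁ : 0 < r₁)
    (α : ℝ → ℝ → Euc k₁ → Euc k₂ → Euc k₁)
    (β : ℝ → ℝ → Euc k₁ → Euc k₂ → Euc k₂)
    (hαC2 : ContDiff ℝ 2 (fun p : ℝ × ℝ × Euc k₁ × Euc k₂ => α p.1 p.2.1 p.2.2.1 p.2.2.2))
    (hβC2 : ContDiff ℝ 2 (fun p : ℝ × ℝ × Euc k₁ × Euc k₂ => β p.1 p.2.1 p.2.2.1 p.2.2.2))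
    (M : ℝ) (hM : 0 ≤ M)
    (hA1 : ∀ (ω ε : ℝ) (x : Euc k₁) (y : Euc k₂),
      |ω| ≤ 1 + r₁ → |ε| ≤ 1 + r₁ → ‖y‖ ≤ 1 + r₁ → ∀ i : ℕ, i ≤ 2 →
        ‖iteratedFDeriv ℝ i (fun p : ℝ × ℝ × Euc k₁ × Euc k₂ => α p.1 p.2.1 p.2.2.1 p.2.2.2)
            (ω, ε, x, y)‖ ≤ M ∧
        ‖iteratedFDeriv ℝ i (fun p : ℝ × ℝ × Euc k₁ × Euc k₂ => β p.1 p.2.1 p.2.2.1 p.2.2.2)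
            (ω, ε, x, y)‖ ≤ M)
    (hA2β : ∀ (ω ω' : ℝ) (x x' : Euc k₁) (y : Euc k₂), β ω 0 x y = β ω' 0 x' y)
    (hA20 : β 0 0 0 0 = 0)
    (q : ℝ) (hq0 : 0 ≤ q)
    (hA3q : ∀ y₁ y₂ : Euc k₂, ‖y₁‖ ≤ r₁ → ‖y₂‖ ≤ r₁ →
      ‖β 0 0 0 y₁ - β 0 0 0 y₂‖ ≤ q * ‖y₁ - y₂‖)
    (s e : ℝ) (hs : |s| ≤ 1) (he : |e| ≤ r₁) (x : Euc k₁) (y y' : Euc k₂)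
    (hy : ‖y‖ ≤ r₁) (hy' : ‖y'‖ ≤ r₁) :
    ‖α s e x y - α s e x y'‖ ≤ M * ‖y - y'‖ ∧
    ‖β s e x y - β s e x y'‖ ≤ (q + M * |e|) * ‖y - y'‖ ∧
    ‖β s e x y‖ ≤ q * ‖y‖ + M * |e| := by
  set S : Set (ℝ × ℝ × Euc k₁ × Euc k₂) :=
    Metric.closedBall 0 (1 + r₁) ×ˢ (Metric.closedBall 0 (1 + r₁) ×ˢ
      ((Set.univ : Set (Euc k₁)) ×ˢ Metric.closedBall 0 (1 + r₁))) with hSdef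
  have hS : Convex ℝ S := (convex_closedBall _ _).prod ((convex_closedBall _ _).prod
    (convex_univ.prod (convex_closedBall _ _)))
  have mem : ∀ p : ℝ × ℝ × Euc k₁ × Euc k₂, p ∈ S ↔
      |p.1| ≤ 1 + r₁ ∧ |p.2.1| ≤ 1 + r₁ ∧ ‖p.2.2.2‖ ≤ 1 + r₁ := by
    intro p
    simp [hSdef, Set.mem_prod, Real.norm_eq_abs]
  have key : ∀ p ∈ S, ∀ i ≤ 2, _ := fun p hp i hi =>
    hA1 p.1 p.2.1 p.2.2.1 p.2.2.2 ((mem p).1 hp).1 ((mem p).1 hp).2.1 ((mem p).1 hp).2.2 i hi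
  have m1 : ∀ w : Euc k₂, ‖w‖ ≤ r₁ → (s, e, x, w) ∈ S := fun w hw =>
    (mem _).2 ⟨by simp only; linarith, by simp only; linarith, by simp only; linarith⟩
  have m0 : ∀ w : Euc k₂, ‖w‖ ≤ r₁ → (s, (0:ℝ), x, w) ∈ S := fun w hw =>
    (mem _).2 ⟨by simp only; linarith, by simp only [abs_zero]; linarith,
      by simp only; linarith⟩
  have hv : ∀ w : Euc k₂, (s, (0:ℝ), x, w) + ((0:ℝ), e, (0 : Euc k₁), (0 : Euc k₂)) = (s, e, x, w) := by
    intro w; simp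
  have nv : ‖((0:ℝ), e, (0 : Euc k₁), (0 : Euc k₂))‖ = |e| := by
    simp [Prod.norm_def]
  have nd : ∀ c : ℝ, ‖(s, c, x, y) - (s, c, x, y')‖ = ‖y - y'‖ := by
    intro c; simp [Prod.norm_def]
  have ne : ‖(s, e, x, y) - (s, (0:ℝ), x, y)‖ = |e| := by
    simp [Prod.norm_def]
  refine ⟨?_, ?_, ?_⟩
  · have := aux_lip _ hαC2 S hS M (fun p hp => (key p hp 1 (by norm_num)).1) _ (m1 y hy) _ (m1 y' hy')
    rwa [nd] at this
  · have := aux_lip2 _ hβC2 S hS M (fun p hp => (key p hp 2 (by norm_num)).2)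
      ((0:ℝ), e, (0 : Euc k₁), (0 : Euc k₂)) _ (m0 y hy) (by rw [hv]; exact m1 y hy)
      _ (m0 y' hy') (by rw [hv]; exact m1 y' hy')
    rw [hv, hv, nd, nv] at this
    simp only at this
    have h3 := hA3q y y' hy hy'
    rw [hA2β s 0 x 0 y, hA2β s 0 x 0 y'] at this
    have e1 : β s e x y - β s e x y' =
      ((β s e x y - β 0 0 0 y) - (β s e x y' - β 0 0 0 y')) + (β 0 0 0 y - β 0 0 0 y') := by abel
    rw [e1]
    refine (norm_add_le _ _).trans ?_
    linarith
  · have := aux_lip _ hβC2 S hS M (fun p hp => (key p hp 1 (by norm_num)).2) _ (m1 y hy) _ (m0 y hy)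
    rw [ne] at this
    simp only at this
    rw [hA2β s 0 x 0 y] at this
    have h3 := hA3q y 0 hy (by simpa using hr₁.le)
    rw [hA20, sub_zero, sub_zero] at h3
    have e1 : β s e x y = (β s e x y - β 0 0 0 y) + β 0 0 0 y := by abel
    rw [e1]
    refine (norm_add_le _ _).trans ?_
    linarith

/-- Lemma 2.12: trajectories of `(x,y) ↦ [F_λ(ω,ε,x,y)]_{3-4}` starting in the `r₁/2`-ball
are defined for all times and converge geometrically (hence uniformly) to the graph of `ψ`. -/
theorem stmt11 (k₁ k₂ : ℕ) (r₁ : ℝ) (hr₁ : 0 < r₁)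
    (α : ℝ → ℝ → Euc k₁ → Euc k₂ → Euc k₁)
    (β : ℝ → ℝ → Euc k₁ → Euc k₂ → Euc k₂)
    (hαC2 : ContDiff ℝ 2 (fun p : ℝ × ℝ × Euc k₁ × Euc k₂ => α p.1 p.2.1 p.2.2.1 p.2.2.2))
    (hβC2 : ContDiff ℝ 2 (fun p : ℝ × ℝ × Euc k₁ × Euc k₂ => β p.1 p.2.1 p.2.2.1 p.2.2.2))
    (hA1 : ∀ C : ℝ, ∃ M : ℝ, ∀ (ω ε : ℝ) (x : Euc k₁) (y : Euc k₂),
      |ω| ≤ C → |ε| ≤ C → ‖y‖ ≤ C → ∀ i : ℕ, i ≤ 2 →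
        ‖iteratedFDeriv ℝ i (fun p : ℝ × ℝ × Euc k₁ × Euc k₂ => α p.1 p.2.1 p.2.2.1 p.2.2.2)
            (ω, ε, x, y)‖ ≤ M ∧
        ‖iteratedFDeriv ℝ i (fun p : ℝ × ℝ × Euc k₁ × Euc k₂ => β p.1 p.2.1 p.2.2.1 p.2.2.2)
            (ω, ε, x, y)‖ ≤ M)
    (hA2α : ∀ (ω ω' : ℝ) (x x' : Euc k₁) (y : Euc k₂), α ω 0 x y = α ω' 0 x' y)
    (hA2β : ∀ (ω ω' : ℝ) (x x' : Euc k₁) (y : Euc k₂), β ω 0 x y = β ω' 0 x' y)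
    (hA20 : β 0 0 0 0 = 0)
    (hA3inv : ∃ Beq : Euc k₂ ≃L[ℝ] Euc k₂,
      (Beq : Euc k₂ →L[ℝ] Euc k₂) = fderiv ℝ (fun y : Euc k₂ => β 0 0 0 y) 0)
    (q : ℝ) (hq0 : 0 ≤ q) (hq1 : q < 1)
    (hA3q : ∀ y₁ y₂ : Euc k₂, ‖y₁‖ ≤ r₁ → ‖y₂‖ ≤ r₁ →
      ‖β 0 0 0 y₁ - β 0 0 0 y₂‖ ≤ q * ‖y₁ - y₂‖) :
    ∃ l₀ : ℝ, 0 < l₀ ∧ l₀ ≤ 1 ∧ ∀ l : ℝ, 0 < l → l ≤ l₀ →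
      ∀ ψ : ℝ × ℝ × Euc k₁ → Euc k₂, ContDiff ℝ 1 ψ →
        (∀ p : ℝ × ℝ × Euc k₁, ‖fderiv ℝ ψ p‖ ≤ 1) →
        (∀ p : ℝ × ℝ × Euc k₁, ‖ψ p‖ ≤ r₁ / 2) →
        (∀ ω' ∈ Icc (0:ℝ) (1 / l), ∀ ε' ∈ Ioo (-(r₁ / 2)) (r₁ / 2),
          Flam α β l '' SliceT ψ ω' ε' = SliceT ψ ω' ε') →
        ∀ ω ∈ Icc (0:ℝ) (1 / l), ∀ ε ∈ Ioo (-(r₁ / 2)) (r₁ / 2),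
          (∀ z₀ : Euc k₁ × Euc k₂, ‖z₀.2‖ ≤ r₁ / 2 → ∀ j : ℕ,
            ‖((Flam34 α β l ω ε)^[j] z₀).2‖ ≤ r₁ ∧
            ‖((Flam34 α β l ω ε)^[j] z₀).2 - ψ (ω, ε, ((Flam34 α β l ω ε)^[j] z₀).1)‖ ≤
              (q + 2 * (1 - q) / 3) ^ j * ‖z₀.2 - ψ (ω, ε, z₀.1)‖) ∧
          (∀ δ : ℝ, 0 < δ → ∃ N : ℕ, ∀ z₀ : Euc k₁ × Euc k₂, ‖z₀.2‖ ≤ r₁ / 2 →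
            ∀ j : ℕ, N ≤ j →
              ‖((Flam34 α β l ω ε)^[j] z₀).2 - ψ (ω, ε, ((Flam34 α β l ω ε)^[j] z₀).1)‖ ≤ δ) := by
  obtain ⟨M₀, hM₀⟩ := hA1 (1 + r₁)
  set M := max M₀ 0 with hMdef
  have hM : 0 ≤ M := le_max_right _ _
  have hMb := fun (ω ε : ℝ) (x : Euc k₁) (y : Euc k₂) h1 h2 h3 (i : ℕ) (hi : i ≤ 2) =>
    And.intro ((hM₀ ω ε x y h1 h2 h3 i hi).1.trans (le_max_left M₀ 0))
      ((hM₀ ω ε x y h1 h2 h3 i hi).2.trans (le_max_left M₀ 0))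
  have hD : 0 < 3 * (M + 1) * (1 + r₁) := by positivity
  refine ⟨min 1 ((1 - q) / (3 * (M + 1) * (1 + r₁))), lt_min one_pos (div_pos (by linarith) hD),
    min_le_left _ _, ?_⟩
  intro l hl hll ψ hψ hψd hψb hinv ω hω ε hε
  have hl1 : l ≤ 1 := hll.trans (min_le_left _ _)
  have hl2 : l * (3 * (M + 1) * (1 + r₁)) ≤ 1 - q := by
    rw [← le_div_iff₀ hD]; exact hll.trans (min_le_right _ _)
  have hlM : 0 ≤ l * M := by positivity
  have hlMr : 0 ≤ l * M * r₁ := by positivity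
  have hlr : 0 ≤ l * r₁ := by positivity
  have hb1 : l * M ≤ (1 - q) / 3 := by nlinarith
  have hb2 : l * M * r₁ ≤ (1 - q) / 3 := by nlinarith
  have hs0 : 0 ≤ l * ω := mul_nonneg hl.le hω.1
  have hs1 : l * ω ≤ 1 := by
    have := mul_le_mul_of_nonneg_left hω.2 hl.le
    rwa [mul_one_div_cancel hl.ne'] at this
  have hs : |l * ω| ≤ 1 := by rw [abs_of_nonneg hs0]; exact hs1
  have hεa : |ε| ≤ r₁ / 2 := abs_le.2 ⟨hε.1.le, hε.2.le⟩
  have hea : |l ^ 2 * ε| ≤ l ^ 2 * (r₁ / 2) := by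
    rw [abs_mul, abs_of_nonneg (sq_nonneg l)]
    exact mul_le_mul_of_nonneg_left hεa (sq_nonneg l)
  have hll2 : l ^ 2 ≤ l := by nlinarith
  have he : |l ^ 2 * ε| ≤ r₁ := by nlinarith
  have hly : ∀ y : Euc k₂, ‖y‖ ≤ r₁ / 2 → ‖l • y‖ ≤ r₁ := by
    intro y hy
    rw [norm_smul, Real.norm_of_nonneg hl.le]
    nlinarith [norm_nonneg y]
  have step := fun x y y' hy hy' => aux_step k₁ k₂ r₁ hr₁ α β hαC2 hβC2 M hM hMb hA2β hA20 q hq0 hA3q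
    (l * ω) (l ^ 2 * ε) hs he x (l • y) (l • y') (hly y hy) (hly y' hy')
  have F1 : ∀ z : Euc k₁ × Euc k₂, (Flam34 α β l ω ε z).1 =
      z.1 + (l * ω) • α (l * ω) (l ^ 2 * ε) z.1 (l • z.2) := by
    intro z
    simp only [Flam34, Flam, tAl, smul_sub]
    abel
  have F2 : ∀ z : Euc k₁ × Euc k₂, (Flam34 α β l ω ε z).2 =
      (1 / l) • β (l * ω) (l ^ 2 * ε) z.1 (l • z.2) := by
    intro z
    simp only [Flam34, Flam, tBl]
    abel
  have hinv' : ∀ x : Euc k₁, (Flam34 α β l ω ε (x, ψ (ω, ε, x))).2 =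
      ψ (ω, ε, (Flam34 α β l ω ε (x, ψ (ω, ε, x))).1) := by
    intro x
    have h1 : Flam α β l (ω, ε, x, ψ (ω, ε, x)) ∈ SliceT ψ ω ε := by
      rw [← hinv ω hω ε hε]
      exact ⟨_, ⟨rfl, rfl, rfl⟩, rfl⟩
    exact h1.2.2
  have hψL : ∀ x x' : Euc k₁, ‖ψ (ω, ε, x) - ψ (ω, ε, x')‖ ≤ ‖x - x'‖ := by
    intro x x'
    have := convex_univ.norm_image_sub_le_of_norm_fderiv_le (𝕜 := ℝ) (f := ψ) (C := 1)
      (fun p _ => (hψ.differentiable (by norm_num)) p) (fun p _ => hψd p)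
      (Set.mem_univ (ω, ε, x')) (Set.mem_univ (ω, ε, x))
    simpa [Prod.norm_def] using this
  have B1 : ∀ z : Euc k₁ × Euc k₂, ‖z.2‖ ≤ r₁ / 2 → ‖(Flam34 α β l ω ε z).2‖ ≤ r₁ / 2 := by
    intro z hz
    have h := (step z.1 z.2 z.2 hz hz).2.2
    rw [norm_smul, Real.norm_of_nonneg hl.le] at h
    rw [F2, norm_smul, Real.norm_of_nonneg (by positivity), one_div, inv_mul_le_iff₀ hl]
    have a1 : q * (l * ‖z.2‖) ≤ q * (l * (r₁ / 2)) := by gcongr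
    have a2 : M * |l ^ 2 * ε| ≤ M * (l ^ 2 * (r₁ / 2)) := by gcongr
    have a3 : (l * (r₁ / 2)) * (l * M) ≤ (l * (r₁ / 2)) * (1 - q) :=
      mul_le_mul_of_nonneg_left (by linarith) (by positivity)
    nlinarith
  have B2 : ∀ z : Euc k₁ × Euc k₂, ‖z.2‖ ≤ r₁ / 2 →
      ‖(Flam34 α β l ω ε z).2 - ψ (ω, ε, (Flam34 α β l ω ε z).1)‖ ≤
        (q + 2 * (1 - q) / 3) * ‖z.2 - ψ (ω, ε, z.1)‖ := by
    intro z hz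
    set η := ψ (ω, ε, z.1) with hη
    obtain ⟨h1, h2, -⟩ := step z.1 z.2 η hz (hψb _)
    rw [← smul_sub, norm_smul, Real.norm_of_nonneg hl.le] at h1 h2
    have c1 : ‖(Flam34 α β l ω ε (z.1, η)).1 - (Flam34 α β l ω ε z).1‖ ≤ l * M * ‖z.2 - η‖ := by
      rw [F1, F1, norm_sub_rev]
      simp only
      rw [add_sub_add_left_eq_sub, ← smul_sub, norm_smul, Real.norm_of_nonneg hs0]
      calc _ ≤ 1 * (M * (l * ‖z.2 - η‖)) := by gcongr
        _ = _ := by ring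
    have c2 : ‖(Flam34 α β l ω ε z).2 - (Flam34 α β l ω ε (z.1, η)).2‖ ≤
        (q + M * |l ^ 2 * ε|) * ‖z.2 - η‖ := by
      rw [F2, F2]
      simp only
      rw [← smul_sub, norm_smul, Real.norm_of_nonneg (by positivity), one_div,
        inv_mul_le_iff₀ hl]
      linarith
    have c3 := hψL (Flam34 α β l ω ε (z.1, η)).1 (Flam34 α β l ω ε z).1
    have c4 := hinv' z.1
    rw [← hη] at c4
    rw [← c4] at c3
    have e1 : (Flam34 α β l ω ε z).2 - ψ (ω, ε, (Flam34 α β l ω ε z).1) =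
      ((Flam34 α β l ω ε z).2 - (Flam34 α β l ω ε (z.1, η)).2) +
      ((Flam34 α β l ω ε (z.1, η)).2 - ψ (ω, ε, (Flam34 α β l ω ε z).1)) := by abel
    have a2 : M * |l ^ 2 * ε| ≤ (1 - q) / 3 := by
      have : M * |l ^ 2 * ε| ≤ M * (l * (r₁ / 2)) := by
        refine mul_le_mul_of_nonneg_left (hea.trans ?_) hM
        gcongr
      nlinarith
    have a3 : (q + M * |l ^ 2 * ε| + l * M) * ‖z.2 - η‖ ≤
        (q + 2 * (1 - q) / 3) * ‖z.2 - η‖ :=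
      mul_le_mul_of_nonneg_right (by linarith) (norm_nonneg _)
    rw [e1]
    refine (norm_add_le _ _).trans ?_
    linarith
  have hc0 : 0 ≤ q + 2 * (1 - q) / 3 := by linarith
  have hc1 : q + 2 * (1 - q) / 3 < 1 := by linarith
  have main : ∀ z₀ : Euc k₁ × Euc k₂, ‖z₀.2‖ ≤ r₁ / 2 → ∀ j : ℕ,
      ‖((Flam34 α β l ω ε)^[j] z₀).2‖ ≤ r₁ / 2 ∧
      ‖((Flam34 α β l ω ε)^[j] z₀).2 - ψ (ω, ε, ((Flam34 α β l ω ε)^[j] z₀).1)‖ ≤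
        (q + 2 * (1 - q) / 3) ^ j * ‖z₀.2 - ψ (ω, ε, z₀.1)‖ := by
    intro z₀ hz j
    induction j with
    | zero => simpa using hz
    | succ n ih =>
      rw [Function.iterate_succ_apply']
      refine ⟨B1 _ ih.1, (B2 _ ih.1).trans ?_⟩
      rw [pow_succ', mul_assoc]
      exact mul_le_mul_of_nonneg_left ih.2 hc0
  refine ⟨fun z₀ hz j => ⟨by linarith [(main z₀ hz j).1], (main z₀ hz j).2⟩, ?_⟩
  intro δ hδ
  obtain ⟨N, hN⟩ := exists_pow_lt_of_lt_one (div_pos hδ hr₁) hc1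
  refine ⟨N, fun z₀ hz j hj => ((main z₀ hz j).2).trans ?_⟩
  have b1 : ‖z₀.2 - ψ (ω, ε, z₀.1)‖ ≤ r₁ := by
    have := norm_sub_le z₀.2 (ψ (ω, ε, z₀.1))
    have := hψb (ω, ε, z₀.1)
    linarith
  have b2 : (q + 2 * (1 - q) / 3) ^ j ≤ δ / r₁ :=
    (pow_le_pow_of_le_one hc0 hc1.le hj).trans hN.le
  calc _ ≤ δ / r₁ * r₁ := by gcongr
    _ = δ := by field_simp
end

section
/- (Corollary 2.13) Under assumptions (A1)–(A3) there exists λ₀ ∈ (0,1] such that for every λ ∈ (0,λ₀], every ω ∈ [0,1], and every ε with ε/λ² ∈ (−r₁/2, r₁/2), the following holds. Let ψ ∈ C¹(ℝ×ℝ×ℝ^{k₁}, ℝ^{k₂}) be 1-Lipschitz with ‖ψ‖ ≤ r₁/2 everywhere and with all slices F_λ-invariant for ω' ∈ [0,1/λ], ε' ∈ (−r₁/2,r₁/2). Then the trajectory (x_j,y_j)_{j≥0} of (x,y) ↦ [F₁(ω,ε,x,y)]_{3−4} = f_{ω,ε}(x,y) with any initial condition (x₀,y₀) ∈ ℝ^{k₁}×(λr₁/2)𝔻^{k₂}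 is defined for all j ∈ ℕ and ‖y_j − λψ(ω/λ, ε/λ², x_j)‖ → 0 as j → ∞, uniformly with respect to (x₀,y₀). -/
open Set

/-- The map `f_{ω,ε}(x,y) = (x + ω·α(ω,ε,x,y), β(ω,ε,x,y))`. -/
noncomputable def fmap {k₁ k₂ : ℕ} (α : ℝ → ℝ → Euc k₁ → Euc k₂ → Euc k₁)
    (β : ℝ → ℝ → Euc k₁ → Euc k₂ → Euc k₂) (ω ε : ℝ)
    (p : Euc k₁ × Euc k₂) : Euc k₁ × Euc k₂ :=
  (p.1 + ω • α ω ε p.1 p.2, β ω ε p.1 p.2)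

lemma lipA {E F : Type*} [NormedAddCommGroup E] [NormedSpace ℝ E] [NormedAddCommGroup F]
    [NormedSpace ℝ F] (b : E → F) (hb : ContDiff ℝ 2 b) (S : Set E) (hS : Convex ℝ S) (M : ℝ)
    (hM : ∀ p ∈ S, ‖iteratedFDeriv ℝ 1 b p‖ ≤ M) {p p' : E} (hp : p ∈ S) (hp' : p' ∈ S) :
    ‖b p - b p'‖ ≤ M * ‖p - p'‖ := by
  refine hS.norm_image_sub_le_of_norm_fderiv_le (𝕜 := ℝ)
    (fun x _ => (hb.differentiable (by norm_num)) x) (fun x hx => ?_) hp' hp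
  rw [← norm_iteratedFDeriv_one]
  exact hM x hx

lemma lipB {E F : Type*} [NormedAddCommGroup E] [NormedSpace ℝ E] [NormedAddCommGroup F]
    [NormedSpace ℝ F] (b : E → F) (hb : ContDiff ℝ 2 b) (S : Set E) (hS : Convex ℝ S) (M : ℝ)
    (hM : ∀ p ∈ S, ‖iteratedFDeriv ℝ 2 b p‖ ≤ M) {p p' : E} (e : E) (hp : p ∈ S) (hp' : p' ∈ S)
    (hpe : p + e ∈ S) (hpe' : p' + e ∈ S) :
    ‖(b (p + e) - b p) - (b (p' + e) - b p')‖ ≤ (M * ‖e‖) * ‖p - p'‖ := by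
  have hd : Differentiable ℝ b := hb.differentiable (by norm_num)
  have hfd : ContDiff ℝ 1 (fderiv ℝ b) := hb.fderiv_right (by norm_num)
  have hT : Convex ℝ (S ∩ (fun z => z + e) ⁻¹' S) :=
    hS.inter (hS.translate_preimage_left e)
  refine hT.norm_image_sub_le_of_norm_hasFDerivWithin_le (𝕜 := ℝ)
    (f := fun z => b (z + e) - b z)
    (f' := fun z => fderiv ℝ b (z + e) - fderiv ℝ b z)
    (fun x _ => ?_) (fun x hx => ?_) ⟨hp', hpe'⟩ ⟨hp, hpe⟩
  · exact (((hasFDerivAt_comp_add_right e).2 (hd (x + e)).hasFDerivAt).sub (hd x).hasFDerivAt).hasFDerivWithinAt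
  · have := hS.norm_image_sub_le_of_norm_fderiv_le (𝕜 := ℝ) (f := fderiv ℝ b) (C := M)
      (fun x _ => (hfd.differentiable (by norm_num)) x) (fun z hz => ?_) hx.1 hx.2
    · simpa using this
    · rw [← norm_iteratedFDeriv_one, norm_iteratedFDeriv_fderiv]
      exact hM z hz

set_option maxHeartbeats 2000000 in
/-- Corollary 2.13: trajectories of `f_{ω,ε} = [F₁(ω,ε,·,·)]_{3-4}` starting in the
`λr₁/2`-ball are defined for all times and approach `x ↦ λψ(ω/λ, ε/λ², x)` uniformly. -/
theorem stmt12 (k₁ k₂ : ℕ) (r₁ : ℝ) (hr₁ : 0 < r₁)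
    (α : ℝ → ℝ → Euc k₁ → Euc k₂ → Euc k₁)
    (β : ℝ → ℝ → Euc k₁ → Euc k₂ → Euc k₂)
    (hαC2 : ContDiff ℝ 2 (fun p : ℝ × ℝ × Euc k₁ × Euc k₂ => α p.1 p.2.1 p.2.2.1 p.2.2.2))
    (hβC2 : ContDiff ℝ 2 (fun p : ℝ × ℝ × Euc k₁ × Euc k₂ => β p.1 p.2.1 p.2.2.1 p.2.2.2))
    (hA1 : ∀ C : ℝ, ∃ M : ℝ, ∀ (ω ε : ℝ) (x : Euc k₁) (y : Euc k₂),
      |ω| ≤ C → |ε| ≤ C → ‖y‖ ≤ C → ∀ i : ℕ, i ≤ 2 →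
        ‖iteratedFDeriv ℝ i (fun p : ℝ × ℝ × Euc k₁ × Euc k₂ => α p.1 p.2.1 p.2.2.1 p.2.2.2)
            (ω, ε, x, y)‖ ≤ M ∧
        ‖iteratedFDeriv ℝ i (fun p : ℝ × ℝ × Euc k₁ × Euc k₂ => β p.1 p.2.1 p.2.2.1 p.2.2.2)
            (ω, ε, x, y)‖ ≤ M)
    (hA2α : ∀ (ω ω' : ℝ) (x x' : Euc k₁) (y : Euc k₂), α ω 0 x y = α ω' 0 x' y)
    (hA2β : ∀ (ω ω' : ℝ) (x x' : Euc k₁) (y : Euc k₂), β ω 0 x y = β ω' 0 x' y)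
    (hA20 : β 0 0 0 0 = 0)
    (hA3inv : ∃ Beq : Euc k₂ ≃L[ℝ] Euc k₂,
      (Beq : Euc k₂ →L[ℝ] Euc k₂) = fderiv ℝ (fun y : Euc k₂ => β 0 0 0 y) 0)
    (q : ℝ) (hq0 : 0 ≤ q) (hq1 : q < 1)
    (hA3q : ∀ y₁ y₂ : Euc k₂, ‖y₁‖ ≤ r₁ → ‖y₂‖ ≤ r₁ →
      ‖β 0 0 0 y₁ - β 0 0 0 y₂‖ ≤ q * ‖y₁ - y₂‖) :
    ∃ l₀ : ℝ, 0 < l₀ ∧ l₀ ≤ 1 ∧ ∀ l : ℝ, 0 < l → l ≤ l₀ →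
      ∀ ω ∈ Icc (0:ℝ) 1, ∀ ε : ℝ, ε / l ^ 2 ∈ Ioo (-(r₁ / 2)) (r₁ / 2) →
        ∀ ψ : ℝ × ℝ × Euc k₁ → Euc k₂, ContDiff ℝ 1 ψ →
          (∀ p : ℝ × ℝ × Euc k₁, ‖fderiv ℝ ψ p‖ ≤ 1) →
          (∀ p : ℝ × ℝ × Euc k₁, ‖ψ p‖ ≤ r₁ / 2) →
          (∀ ω' ∈ Icc (0:ℝ) (1 / l), ∀ ε' ∈ Ioo (-(r₁ / 2)) (r₁ / 2),
            Flam α β l '' SliceT ψ ω' ε' = SliceT ψ ω' ε') →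
          (∀ z₀ : Euc k₁ × Euc k₂, ‖z₀.2‖ ≤ l * r₁ / 2 → ∀ j : ℕ,
            ‖((fmap α β ω ε)^[j] z₀).2‖ ≤ r₁) ∧
          (∀ δ : ℝ, 0 < δ → ∃ N : ℕ, ∀ z₀ : Euc k₁ × Euc k₂, ‖z₀.2‖ ≤ l * r₁ / 2 →
            ∀ j : ℕ, N ≤ j →
              ‖((fmap α β ω ε)^[j] z₀).2 -
                l • ψ (ω / l, ε / l ^ 2, ((fmap α β ω ε)^[j] z₀).1)‖ ≤ δ) := by
  obtain ⟨M, hM⟩ := hA1 (max 1 r₁)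
  set C : ℝ := max 1 r₁ with hC
  have hC1 : 1 ≤ C := le_max_left _ _
  have hCr : r₁ ≤ C := le_max_right _ _
  set a : ℝ × ℝ × Euc k₁ × Euc k₂ → Euc k₁ := fun p => α p.1 p.2.1 p.2.2.1 p.2.2.2 with ha
  set b : ℝ × ℝ × Euc k₁ × Euc k₂ → Euc k₂ := fun p => β p.1 p.2.1 p.2.2.1 p.2.2.2 with hb
  set S : Set (ℝ × ℝ × Euc k₁ × Euc k₂) :=
    {p | |p.1| ≤ C ∧ |p.2.1| ≤ C ∧ ‖p.2.2.2‖ ≤ C} with hSdef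
  have hS : Convex ℝ S := by
    have h1 : Convex ℝ {p : ℝ × ℝ × Euc k₁ × Euc k₂ | |p.1| ≤ C} := by
      have := (convex_closedBall (0:ℝ) C).linear_preimage
        (LinearMap.fst ℝ ℝ (ℝ × Euc k₁ × Euc k₂))
      simpa [Set.preimage, Metric.closedBall, Real.norm_eq_abs] using this
    have h2 : Convex ℝ {p : ℝ × ℝ × Euc k₁ × Euc k₂ | |p.2.1| ≤ C} := by
      have := (convex_closedBall (0:ℝ) C).linear_preimage
        ((LinearMap.fst ℝ ℝ (Euc k₁ × Euc k₂)).comp (LinearMap.snd ℝ ℝ (ℝ × Euc k₁ × Euc k₂)))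
      simpa [Set.preimage, Metric.closedBall, Real.norm_eq_abs] using this
    have h3 : Convex ℝ {p : ℝ × ℝ × Euc k₁ × Euc k₂ | ‖p.2.2.2‖ ≤ C} := by
      have := (convex_closedBall (0:Euc k₂) C).linear_preimage
        ((LinearMap.snd ℝ (Euc k₁) (Euc k₂)).comp ((LinearMap.snd ℝ ℝ (Euc k₁ × Euc k₂)).comp
          (LinearMap.snd ℝ ℝ (ℝ × Euc k₁ × Euc k₂))))
      simpa [Set.preimage, Metric.closedBall] using this
    exact h1.inter (h2.inter h3)
  set K : ℝ := max M 0 with hK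
  have hK0 : 0 ≤ K := le_max_right _ _
  have hMK : M ≤ K := le_max_left _ _
  have ha1 : ∀ p ∈ S, ‖iteratedFDeriv ℝ 1 a p‖ ≤ K := fun p hp =>
    ((hM p.1 p.2.1 p.2.2.1 p.2.2.2 hp.1 hp.2.1 hp.2.2 1 (by norm_num)).1).trans hMK
  have hb1 : ∀ p ∈ S, ‖iteratedFDeriv ℝ 1 b p‖ ≤ K := fun p hp =>
    ((hM p.1 p.2.1 p.2.2.1 p.2.2.2 hp.1 hp.2.1 hp.2.2 1 (by norm_num)).2).trans hMK
  have hb2 : ∀ p ∈ S, ‖iteratedFDeriv ℝ 2 b p‖ ≤ K := fun p hp =>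
    ((hM p.1 p.2.1 p.2.2.1 p.2.2.2 hp.1 hp.2.1 hp.2.2 2 (by norm_num)).2).trans hMK
  have hD : 0 < 2 * (K * (r₁ / 2 + 1) + 1) := by positivity
  refine ⟨min 1 ((1 - q) / (2 * (K * (r₁ / 2 + 1) + 1))),
    lt_min one_pos (div_pos (by linarith) hD), min_le_left _ _, ?_⟩
  intro l hl hll ω hω ε hε ψ hψ hψ1 hψb hinv
  have hl1 : l ≤ 1 := hll.trans (min_le_left _ _)
  have hl2 : l * (2 * (K * (r₁ / 2 + 1) + 1)) ≤ 1 - q :=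
    (le_div_iff₀ hD).1 (hll.trans (min_le_right _ _))
  have hlr : l * r₁ ≤ r₁ := by nlinarith
  have hKl : 0 ≤ l * K := by positivity
  have hKlr : 0 ≤ l * (K * (r₁ / 2)) := by positivity
  have hε1 : |ε| ≤ l ^ 2 * (r₁ / 2) := by
    have h : |ε / l ^ 2| ≤ r₁ / 2 := abs_le.2 ⟨hε.1.le, hε.2.le⟩
    rw [abs_div, abs_of_pos (by positivity : (0:ℝ) < l ^ 2), div_le_iff₀ (by positivity)] at h
    linarith
  have hll2 : l ^ 2 ≤ l := by nlinarith
  have hεC : |ε| ≤ C := by nlinarith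
  have hωC : |ω| ≤ C := by rw [abs_of_nonneg hω.1]; exact hω.2.trans hC1
  have hC0 : |(0:ℝ)| ≤ C := by simp; linarith
  -- the bound for β - β(0)
  have hβ1 : ∀ (x : Euc k₁) (y : Euc k₂), ‖y‖ ≤ l * r₁ / 2 →
      ‖β ω ε x y‖ ≤ l * r₁ / 2 := by
    intro x y hy
    have hyC : ‖y‖ ≤ C := by linarith
    have h1 := lipA b hβC2 S hS K hb1 (p := (ω, ε, x, y)) (p' := (ω, 0, x, y))
      ⟨hωC, hεC, hyC⟩ ⟨hωC, hC0, hyC⟩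
    have h2 := hA3q y 0 (by linarith) (by simpa using hr₁.le)
    rw [hA20, sub_zero, sub_zero] at h2
    have h3 : β ω 0 x y = β 0 0 0 y := hA2β _ _ _ _ _
    simp only [hb, h3, Prod.mk_sub_mk, sub_self, sub_zero, Prod.norm_mk, norm_zero,
      Real.norm_eq_abs] at h1
    simp at h1
    have h4 : ‖β ω ε x y‖ ≤ ‖β ω ε x y - β 0 0 0 y‖ + ‖β 0 0 0 y‖ := by
      simpa using norm_add_le (β ω ε x y - β 0 0 0 y) (β 0 0 0 y)
    have h5 : K * |ε| ≤ K * (l ^ 2 * (r₁ / 2)) := by gcongr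
    have h6 : q * ‖y‖ ≤ q * (l * r₁ / 2) := by gcongr
    have h7 : l * K ≤ 1 - q := by nlinarith
    have h8 : 0 ≤ l * r₁ / 2 := by positivity
    nlinarith
  have hβ2 : ∀ (x : Euc k₁) (y y' : Euc k₂), ‖y‖ ≤ l * r₁ / 2 → ‖y'‖ ≤ l * r₁ / 2 →
      ‖β ω ε x y - β ω ε x y'‖ ≤ (q + K * (l * (r₁ / 2))) * ‖y - y'‖ := by
    intro x y y' hy hy'
    have hyC : ‖y‖ ≤ C := by linarith
    have hyC' : ‖y'‖ ≤ C := by linarith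
    have h1 := lipB b hβC2 S hS K hb2 (p := (ω, 0, x, y)) (p' := (ω, 0, x, y')) (0, ε, 0, 0)
      ⟨hωC, hC0, hyC⟩ ⟨hωC, hC0, hyC'⟩ (by simpa [hSdef] using ⟨hωC, hεC, hyC⟩)
      (by simpa [hSdef] using ⟨hωC, hεC, hyC'⟩)
    have h2 := hA3q y y' (by linarith) (by linarith)
    have h3 : β ω 0 x y = β 0 0 0 y := hA2β _ _ _ _ _
    have h3' : β ω 0 x y' = β 0 0 0 y' := hA2β _ _ _ _ _
    simp [hb, h3, h3', Prod.norm_mk] at h1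
    have h4 : ‖β ω ε x y - β ω ε x y'‖ ≤ ‖β ω ε x y - β 0 0 0 y - (β ω ε x y' - β 0 0 0 y')‖
        + ‖β 0 0 0 y - β 0 0 0 y'‖ := by
      refine le_trans (le_of_eq ?_) (norm_add_le _ _)
      congr 1; abel
    have h5 : K * |ε| * ‖y - y'‖ ≤ K * (l * (r₁ / 2)) * ‖y - y'‖ := by
      gcongr
      exact hε1.trans (by gcongr)
    linarith
  have hα1 : ∀ (x : Euc k₁) (y y' : Euc k₂), ‖y‖ ≤ l * r₁ / 2 → ‖y'‖ ≤ l * r₁ / 2 →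
      ‖α ω ε x y - α ω ε x y'‖ ≤ K * ‖y - y'‖ := by
    intro x y y' hy hy'
    have h1 := lipA a hαC2 S hS K ha1 (p := (ω, ε, x, y)) (p' := (ω, ε, x, y'))
      ⟨hωC, hεC, by linarith⟩ ⟨hωC, hεC, by linarith⟩
    simpa [ha, Prod.norm_mk] using h1
  set g : Euc k₁ → Euc k₂ := fun x => l • ψ (ω / l, ε / l ^ 2, x) with hg
  have hgb : ∀ x, ‖g x‖ ≤ l * r₁ / 2 := by
    intro x
    simp only [hg, norm_smul, Real.norm_eq_abs, abs_of_pos hl]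
    have := mul_le_mul_of_nonneg_left (hψb (ω / l, ε / l ^ 2, x)) hl.le
    linarith
  have hgl : ∀ x x', ‖g x - g x'‖ ≤ l * ‖x - x'‖ := by
    intro x x'
    have h1 := (convex_univ).norm_image_sub_le_of_norm_fderiv_le (𝕜 := ℝ) (f := ψ) (C := 1)
      (fun z _ => (hψ.differentiable (by norm_num)) z) (fun z _ => hψ1 z)
      (mem_univ (ω / l, ε / l ^ 2, x')) (mem_univ (ω / l, ε / l ^ 2, x))
    simp [Prod.norm_mk] at h1
    simp only [hg, ← smul_sub, norm_smul, Real.norm_eq_abs, abs_of_pos hl]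
    gcongr
  have hginv : ∀ x, g (x + ω • α ω ε x (g x)) = β ω ε x (g x) := by
    intro x
    have hω' : ω / l ∈ Icc (0:ℝ) (1 / l) :=
      ⟨div_nonneg hω.1 hl.le, div_le_div_of_nonneg_right hω.2 hl.le⟩
    have h1 : Flam α β l (ω / l, ε / l ^ 2, x, ψ (ω / l, ε / l ^ 2, x)) ∈
        SliceT ψ (ω / l) (ε / l ^ 2) := by
      rw [← hinv _ hω' _ hε]
      exact mem_image_of_mem _ ⟨rfl, rfl, rfl⟩
    have h2 := h1.2.2
    have e1 : l * (ω / l) = ω := by field_simp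
    have e2 : l ^ 2 * (ε / l ^ 2) = ε := by field_simp
    simp only [Flam, tAl, tBl, e1, e2] at h2
    rw [add_sub_cancel] at h2
    have e3 : x + ω • α 0 0 0 0 + ω • (α ω ε x (l • ψ (ω / l, ε / l ^ 2, x)) - α 0 0 0 0)
        = x + ω • α ω ε x (l • ψ (ω / l, ε / l ^ 2, x)) := by
      rw [smul_sub]; abel
    rw [e3] at h2
    simp only [hg]
    rw [← h2, smul_smul, mul_one_div_cancel hl.ne', one_smul]
  have hball : ∀ z₀ : Euc k₁ × Euc k₂, ‖z₀.2‖ ≤ l * r₁ / 2 → ∀ j : ℕ,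
      ‖((fmap α β ω ε)^[j] z₀).2‖ ≤ l * r₁ / 2 := by
    intro z₀ hz j
    induction j with
    | zero => simpa using hz
    | succ j ih =>
      rw [Function.iterate_succ_apply']
      exact hβ1 _ _ ih
  set κ : ℝ := q + K * (l * (r₁ / 2)) + l * K with hκ
  have hκ0 : 0 ≤ κ := by positivity
  have hκ1 : κ < 1 := by
    have : l * (2 * (K * (r₁ / 2 + 1) + 1)) = 2 * (l * (K * (r₁ / 2))) + 2 * (l * K) + 2 * l := by ring
    have : K * (l * (r₁ / 2)) = l * (K * (r₁ / 2)) := by ring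
    linarith
  have hstep : ∀ z : Euc k₁ × Euc k₂, ‖z.2‖ ≤ l * r₁ / 2 →
      ‖(fmap α β ω ε z).2 - g (fmap α β ω ε z).1‖ ≤ κ * ‖z.2 - g z.1‖ := by
    rintro ⟨x, y⟩ hz
    simp only at hz
    simp only [fmap]
    have h1 := hβ2 x y (g x) hz (hgb x)
    have h2 := hgl (x + ω • α ω ε x (g x)) (x + ω • α ω ε x y)
    have h2' : ‖(x + ω • α ω ε x (g x)) - (x + ω • α ω ε x y)‖
        = ω * ‖α ω ε x (g x) - α ω ε x y‖ := by
      rw [add_sub_add_left_eq_sub, ← smul_sub, norm_smul, Real.norm_eq_abs, abs_of_nonneg hω.1]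
    rw [hginv, h2'] at h2
    have h3 := hα1 x (g x) y (hgb x) hz
    rw [norm_sub_rev (g x) y] at h3
    have h4 : l * (ω * ‖α ω ε x (g x) - α ω ε x y‖) ≤ l * (1 * (K * ‖y - g x‖)) := by
      gcongr
      exact hω.2
    have h5 : ‖β ω ε x y - g (x + ω • α ω ε x y)‖ ≤ ‖β ω ε x y - β ω ε x (g x)‖ +
        ‖β ω ε x (g x) - g (x + ω • α ω ε x y)‖ := norm_sub_le_norm_sub_add_norm_sub _ _ _
    rw [hκ]
    linarith
  have hdec : ∀ z₀ : Euc k₁ × Euc k₂, ‖z₀.2‖ ≤ l * r₁ / 2 → ∀ j : ℕ,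
      ‖((fmap α β ω ε)^[j] z₀).2 - g ((fmap α β ω ε)^[j] z₀).1‖ ≤ κ ^ j * (l * r₁) := by
    intro z₀ hz j
    induction j with
    | zero =>
      have := norm_sub_le z₀.2 (g z₀.1)
      have := hgb z₀.1
      simp only [Function.iterate_zero, id, pow_zero]
      linarith
    | succ j ih =>
      rw [Function.iterate_succ_apply']
      refine (hstep _ (hball z₀ hz j)).trans ?_
      rw [pow_succ', mul_assoc]
      gcongr
  refine ⟨fun z₀ hz j => (hball z₀ hz j).trans (by linarith), fun δ hδ => ?_⟩
  have hlr0 : 0 < l * r₁ := by positivity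
  obtain ⟨N, hN⟩ := exists_pow_lt_of_lt_one (div_pos hδ hlr0) hκ1
  refine ⟨N, fun z₀ hz j hj => (hdec z₀ hz j).trans ?_⟩
  have h1 : κ ^ j ≤ κ ^ N := pow_le_pow_of_le_one hκ0 hκ1.le hj
  rw [lt_div_iff₀ hlr0] at hN
  exact (mul_le_mul_of_nonneg_right h1 hlr0.le).trans hN.le
end

section
/- (Corollary 2.17, uniqueness of the invariant attracting graph) Under assumptions (A1)–(A3) there exist ε₀ > 0 and r₀ ∈ (0,r₁] such that for every ω ∈ [0,1] and every ε ∈ (−ε₀,ε₀) the following holds: if φ₁, φ₂ ∈ C¹(ℝ^{k₁}, r₀𝔻^{k₂}) each satisfy (C1) f_{ω,ε}(graph(φᵢ)) = graph(φᵢ) and (C2) every trajectory (x_j,y_j) of f_{ω,ε} with initial condition in ℝ^{k₁}×r₀𝔻^{k₂} is defined for all j ∈ ℕ and ‖y_j − φᵢ(x_j)‖ → 0 as j → ∞ uniformly with respect to the initial condition, then φ₁(x) = φ₂(x) for all x ∈ ℝ^{k₁}. -/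
open Set

/-- `f(graph φ) = graph φ`. -/
def fInv {k₁ k₂ : ℕ} (f : Euc k₁ × Euc k₂ → Euc k₁ × Euc k₂)
    (φ : Euc k₁ → Euc k₂) : Prop :=
  f '' {p : Euc k₁ × Euc k₂ | p.2 = φ p.1} = {p : Euc k₁ × Euc k₂ | p.2 = φ p.1}

/-- Every trajectory starting in `ℝ^{k₁} × r₀𝔻` is defined for all times (stays in the
`r₁`-ball in the `y`-component) and `‖y_j - φ(x_j)‖ → 0` uniformly in the initial condition. -/
def fAttr {k₁ k₂ : ℕ} (f : Euc k₁ × Euc k₂ → Euc k₁ × Euc k₂) (r₀ r₁ : ℝ)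
    (φ : Euc k₁ → Euc k₂) : Prop :=
  (∀ z₀ : Euc k₁ × Euc k₂, ‖z₀.2‖ ≤ r₀ → ∀ j : ℕ, ‖(f^[j] z₀).2‖ ≤ r₁) ∧
  ∀ δ : ℝ, 0 < δ → ∃ N : ℕ, ∀ z₀ : Euc k₁ × Euc k₂, ‖z₀.2‖ ≤ r₀ →
    ∀ j : ℕ, N ≤ j → ‖(f^[j] z₀).2 - φ (f^[j] z₀).1‖ ≤ δ

/-- Corollary 2.17: uniqueness of the invariant attracting graph. -/
theorem stmt15 (k₁ k₂ : ℕ) (r₁ : ℝ) (hr₁ : 0 < r₁)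
    (α : ℝ → ℝ → Euc k₁ → Euc k₂ → Euc k₁)
    (β : ℝ → ℝ → Euc k₁ → Euc k₂ → Euc k₂)
    (hαC2 : ContDiff ℝ 2 (fun p : ℝ × ℝ × Euc k₁ × Euc k₂ => α p.1 p.2.1 p.2.2.1 p.2.2.2))
    (hβC2 : ContDiff ℝ 2 (fun p : ℝ × ℝ × Euc k₁ × Euc k₂ => β p.1 p.2.1 p.2.2.1 p.2.2.2))
    (hA1 : ∀ C : ℝ, ∃ M : ℝ, ∀ (ω ε : ℝ) (x : Euc k₁) (y : Euc k₂),
      |ω| ≤ C → |ε| ≤ C → ‖y‖ ≤ C → ∀ i : ℕ, i ≤ 2 →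
        ‖iteratedFDeriv ℝ i (fun p : ℝ × ℝ × Euc k₁ × Euc k₂ => α p.1 p.2.1 p.2.2.1 p.2.2.2)
            (ω, ε, x, y)‖ ≤ M ∧
        ‖iteratedFDeriv ℝ i (fun p : ℝ × ℝ × Euc k₁ × Euc k₂ => β p.1 p.2.1 p.2.2.1 p.2.2.2)
            (ω, ε, x, y)‖ ≤ M)
    (hA2α : ∀ (ω ω' : ℝ) (x x' : Euc k₁) (y : Euc k₂), α ω 0 x y = α ω' 0 x' y)
    (hA2β : ∀ (ω ω' : ℝ) (x x' : Euc k₁) (y : Euc k₂), β ω 0 x y = β ω' 0 x' y)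
    (hA20 : β 0 0 0 0 = 0)
    (hA3inv : ∃ Beq : Euc k₂ ≃L[ℝ] Euc k₂,
      (Beq : Euc k₂ →L[ℝ] Euc k₂) = fderiv ℝ (fun y : Euc k₂ => β 0 0 0 y) 0)
    (q : ℝ) (hq0 : 0 ≤ q) (hq1 : q < 1)
    (hA3q : ∀ y₁ y₂ : Euc k₂, ‖y₁‖ ≤ r₁ → ‖y₂‖ ≤ r₁ →
      ‖β 0 0 0 y₁ - β 0 0 0 y₂‖ ≤ q * ‖y₁ - y₂‖) :
    ∃ ε₀ : ℝ, 0 < ε₀ ∧ ∃ r₀ : ℝ, 0 < r₀ ∧ r₀ ≤ r₁ ∧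
      ∀ ω ∈ Icc (0:ℝ) 1, ∀ ε ∈ Ioo (-ε₀) ε₀,
        ∀ φ₁ φ₂ : Euc k₁ → Euc k₂,
          ContDiff ℝ 1 φ₁ → (∀ x : Euc k₁, ‖φ₁ x‖ ≤ r₀) →
          fInv (fmap α β ω ε) φ₁ → fAttr (fmap α β ω ε) r₀ r₁ φ₁ →
          ContDiff ℝ 1 φ₂ → (∀ x : Euc k₁, ‖φ₂ x‖ ≤ r₀) →
          fInv (fmap α β ω ε) φ₂ → fAttr (fmap α β ω ε) r₀ r₁ φ₂ →
          ∀ x : Euc k₁, φ₁ x = φ₂ x := by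
  refine ⟨1, one_pos, r₁, hr₁, le_rfl, ?_⟩
  intro ω _ ε _ φ₁ φ₂ _ hb₁ hI₁ _ _ _ _ hT₂ x
  have key : ∀ j : ℕ, ∀ p : Euc k₁ × Euc k₂, p.2 = φ₁ p.1 →
      ∃ z : Euc k₁ × Euc k₂, z.2 = φ₁ z.1 ∧ (fmap α β ω ε)^[j] z = p := by
    intro j
    induction j with
    | zero => intro p hp; exact ⟨p, hp, rfl⟩
    | succ n ih =>
      intro p hp
      have hm : p ∈ (fmap α β ω ε) '' {p : Euc k₁ × Euc k₂ | p.2 = φ₁ p.1} := by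
        rw [show _ = _ from hI₁]
        exact hp
      obtain ⟨w, hw, hwp⟩ := hm
      obtain ⟨z, hz, hzw⟩ := ih w hw
      exact ⟨z, hz, by rw [Function.iterate_succ_apply', hzw, hwp]⟩
  have h0 : ‖φ₁ x - φ₂ x‖ ≤ 0 := by
    refine le_of_forall_pos_le_add fun δ hδ => ?_
    obtain ⟨N, hN⟩ := hT₂.2 δ hδ
    obtain ⟨z, hz, hzp⟩ := key N (x, φ₁ x) rfl
    have h := hN z (by rw [hz]; exact hb₁ _) N le_rfl
    rw [hzp] at h
    simpa using h
  exact sub_eq_zero.mp (norm_le_zero_iff.mp h0)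
end

section
/- (Theorem 3.1, periodicity of the invariant manifold) Assume (A1)–(A3) and additionally (A1'): for some index 1 ≤ k ≤ k₁ and some T > 0, the functions x^k ↦ α(ω,ε,x¹,…,x^k,…,x^{k₁},y) and x^k ↦ β(ω,ε,x¹,…,x^k,…,x^{k₁},y) are T-periodic for all values of the remaining arguments. Then there exist ε₀ > 0 and r₀ ∈ (0,r₁) such that for every ω ∈ [0,1] and ε ∈ (−ε₀,ε₀), any C¹ function φ : ℝ^{k₁} → r₀𝔻^{k₂} satisfying (C1) f_{ω,ε}(graph(φ)) = graph(φ) and (C2) every trajectory (x_j,y_j) of f_{ω,ε} with initial condition in ℝ^{k₁}×r₀𝔻^{k₂} is defined for all j ∈ ℕ with ‖y_j − φ(x_j)‖ → 0 uniformly in the initial condition, is T-periodic in the k-th component of its argument: φ(x + T·e_k) = φ(x) for all x ∈ ℝ^{k₁}, where e_k is the k-th standard basis vector of ℝ^{k₁}. -/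
open Set

/-- Theorem 3.1: if `α` and `β` are `T`-periodic in the `k`-th component of `x`, then the
invariant attracting graph is `T`-periodic in the `k`-th component of its argument. -/
theorem stmt16 (k₁ k₂ : ℕ) (r₁ : ℝ) (hr₁ : 0 < r₁)
    (α : ℝ → ℝ → Euc k₁ → Euc k₂ → Euc k₁)
    (β : ℝ → ℝ → Euc k₁ → Euc k₂ → Euc k₂)
    (hαC2 : ContDiff ℝ 2 (fun p : ℝ × ℝ × Euc k₁ × Euc k₂ => α p.1 p.2.1 p.2.2.1 p.2.2.2))
    (hβC2 : ContDiff ℝ 2 (fun p : ℝ × ℝ × Euc k₁ × Euc k₂ => β p.1 p.2.1 p.2.2.1 p.2.2.2))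
    (hA1 : ∀ C : ℝ, ∃ M : ℝ, ∀ (ω ε : ℝ) (x : Euc k₁) (y : Euc k₂),
      |ω| ≤ C → |ε| ≤ C → ‖y‖ ≤ C → ∀ i : ℕ, i ≤ 2 →
        ‖iteratedFDeriv ℝ i (fun p : ℝ × ℝ × Euc k₁ × Euc k₂ => α p.1 p.2.1 p.2.2.1 p.2.2.2)
            (ω, ε, x, y)‖ ≤ M ∧
        ‖iteratedFDeriv ℝ i (fun p : ℝ × ℝ × Euc k₁ × Euc k₂ => β p.1 p.2.1 p.2.2.1 p.2.2.2)
            (ω, ε, x, y)‖ ≤ M)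
    (hA2α : ∀ (ω ω' : ℝ) (x x' : Euc k₁) (y : Euc k₂), α ω 0 x y = α ω' 0 x' y)
    (hA2β : ∀ (ω ω' : ℝ) (x x' : Euc k₁) (y : Euc k₂), β ω 0 x y = β ω' 0 x' y)
    (hA20 : β 0 0 0 0 = 0)
    (hA3inv : ∃ Beq : Euc k₂ ≃L[ℝ] Euc k₂,
      (Beq : Euc k₂ →L[ℝ] Euc k₂) = fderiv ℝ (fun y : Euc k₂ => β 0 0 0 y) 0)
    (q : ℝ) (hq0 : 0 ≤ q) (hq1 : q < 1)
    (hA3q : ∀ y₁ y₂ : Euc k₂, ‖y₁‖ ≤ r₁ → ‖y₂‖ ≤ r₁ →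
      ‖β 0 0 0 y₁ - β 0 0 0 y₂‖ ≤ q * ‖y₁ - y₂‖)
    (kk : Fin k₁) (T : ℝ) (hT : 0 < T)
    (hperα : ∀ (ω ε : ℝ) (x : Euc k₁) (y : Euc k₂),
      α ω ε (x + EuclideanSpace.single kk T) y = α ω ε x y)
    (hperβ : ∀ (ω ε : ℝ) (x : Euc k₁) (y : Euc k₂),
      β ω ε (x + EuclideanSpace.single kk T) y = β ω ε x y) :
    ∃ ε₀ : ℝ, 0 < ε₀ ∧ ∃ r₀ : ℝ, 0 < r₀ ∧ r₀ < r₁ ∧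
      ∀ ω ∈ Icc (0:ℝ) 1, ∀ ε ∈ Ioo (-ε₀) ε₀,
        ∀ φ : Euc k₁ → Euc k₂,
          ContDiff ℝ 1 φ → (∀ x : Euc k₁, ‖φ x‖ ≤ r₀) →
          fInv (fmap α β ω ε) φ → fAttr (fmap α β ω ε) r₀ r₁ φ →
          ∀ x : Euc k₁, φ (x + EuclideanSpace.single kk T) = φ x := by
  refine ⟨1, one_pos, r₁ / 2, by linarith, by linarith, ?_⟩
  intro ω _ ε _ φ _ hφ hinv hattr x
  set f := fmap α β ω ε with hf
  set e : Euc k₁ := EuclideanSpace.single kk T with he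
  have hcomm : Function.Semiconj (fun p : Euc k₁ × Euc k₂ => (p.1 + e, p.2)) f f := by
    intro p
    simp only [hf, fmap, hperα, hperβ]
    ext1
    · simp only []
      abel
    · rfl
  have hsurj : ∀ n : ℕ, ∀ p : Euc k₁ × Euc k₂, p.2 = φ p.1 →
      ∃ z : Euc k₁ × Euc k₂, z.2 = φ z.1 ∧ f^[n] z = p := by
    intro n
    induction n with
    | zero => intro p hp; exact ⟨p, hp, rfl⟩
    | succ n ih =>
      intro p hp
      obtain ⟨z, hz, hzp⟩ := ih p hp
      have hz' : z ∈ f '' {p : Euc k₁ × Euc k₂ | p.2 = φ p.1} := by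
        have h := hinv
        unfold fInv at h
        rw [h]
        exact hz
      obtain ⟨w, hw, hwz⟩ := hz'
      exact ⟨w, hw, by rw [Function.iterate_succ_apply, hwz, hzp]⟩
  have key : ∀ δ : ℝ, 0 < δ → ‖φ (x + e) - φ x‖ ≤ 0 + δ := by
    intro δ hδ
    obtain ⟨N, hN⟩ := hattr.2 δ hδ
    obtain ⟨z, hz, hzp⟩ := hsurj N (x + e, φ (x + e)) rfl
    have h1 := (hcomm.iterate_right N) (z.1 - e, z.2)
    simp only [sub_add_cancel, Prod.mk.eta] at h1
    rw [hzp] at h1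
    have h2 := hN (z.1 - e, z.2) (by simpa [hz] using hφ z.1) N le_rfl
    have h3 := congrArg Prod.fst h1
    have h4 := congrArg Prod.snd h1
    simp only [add_left_inj] at h3 h4
    rw [h3, h4] at h2
    simpa using h2
  have h0 := le_of_forall_pos_le_add key
  exact sub_eq_zero.mp (norm_le_zero_iff.mp h0)
end
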